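/- For every λ > 0 and every u in X_{λ,A} one has the improved scale-dependent Poincaré inequality with monomial Gaussian weight: ∫_{ℝ^N_*} |∇u|² dμ_{A,λ} ≥ (1/λ²) inf over c ∈ ℝ and d ∈ ℝ^N of ∫_{ℝ^N_*} [ |u − c|² + (1/2) | u − c + d · ∫_{ℝ^N_*} x dμ_A − c |∫_{ℝ^N_*} x dμ_A|² − d · x + c (∫_{ℝ^N_*} x dμ_A) · x |² ] dμ_{A,λ}, where ∫_{ℝ^N_*} x dμ_A denotes the vector with components ∫_{ℝ^N_*} x_j dμ_A. -/

import Mathlib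

open MeasureTheory Real

noncomputable section

/-- The Weyl chamber associated to the monomial weight with exponents `α`. -/
def chamber {N : ℕ} (α : Fin N → ℝ) : Set (EuclideanSpace ℝ (Fin N)) :=
  {x | ∀ i, 0 < α i → 0 < x i}

/-- The monomial weight `x^A = x₁^{α₁} ⋯ x_N^{α_N}`. -/
def monWeight {N : ℕ} (α : Fin N → ℝ) (x : EuclideanSpace ℝ (Fin N)) : ℝ :=
  ∏ i, x i ^ α i

/-- The scale-dependent monomial Gaussian probability measure
`dμ_{A,λ} = x^A e^{-|x|²/(2λ²)} dx / ∫_{ℝ^N_*} x^A e^{-|x|²/(2λ²)} dx`. -/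
def monGaussScaled {N : ℕ} (α : Fin N → ℝ) (lam : ℝ) : Measure (EuclideanSpace ℝ (Fin N)) :=
  (((MeasureTheory.volume.restrict (chamber α)).withDensity
      (fun x => ENNReal.ofReal (monWeight α x * Real.exp (-‖x‖ ^ 2 / (2 * lam ^ 2))))) Set.univ)⁻¹ •
  ((MeasureTheory.volume.restrict (chamber α)).withDensity
      (fun x => ENNReal.ofReal (monWeight α x * Real.exp (-‖x‖ ^ 2 / (2 * lam ^ 2)))))

/-- Membership in the class `N_*`: smooth, compactly supported, with vanishing normal
component of the gradient on the boundary of the Weyl chamber. -/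
def NstarClass {N : ℕ} (α : Fin N → ℝ) (u : EuclideanSpace ℝ (Fin N) → ℝ) : Prop :=
  ContDiff ℝ (⊤ : ℕ∞) u ∧ HasCompactSupport u ∧
    ∀ x : EuclideanSpace ℝ (Fin N), ∀ i, 0 < α i → x i = 0 →
      fderiv ℝ u x (EuclideanSpace.single i 1) = 0

end

/-- The monomial Gaussian probability measure `dμ_A` (scale `λ = 1`). -/
noncomputable def monGauss {N : ℕ} (α : Fin N → ℝ) : Measure (EuclideanSpace ℝ (Fin N)) :=
  monGaussScaled α 1

/-- A square-integrable, centered function which is either zero or of unit norm. -/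
structure IsMode (k : ℝ → ℝ) (μ : Measure ℝ) : Prop where
  measurable : Measurable k
  memLp : MemLp k 2 μ
  integral_eq_zero : ∫ t, k t ∂μ = 0
  unit_or_zero : ∫ t, k t ^ 2 ∂μ = 1 ∨ ∀ t, k t = 0

theorem isMode_zero (μ : Measure ℝ) : IsMode (fun _ => 0) μ :=
  ⟨measurable_const, by simp, by simp, Or.inr fun _ => rfl⟩

/-- The part of `g` orthogonal to the constants and to `k`. -/
noncomputable def modeResidual (μ : Measure ℝ) (k g : ℝ → ℝ) (s : ℝ) : ℝ :=
  g s - ∫ t, g t ∂μ - k s * ∫ t, k t * g t ∂μ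

theorem memLp_modeResidual {μ : Measure ℝ} [IsProbabilityMeasure μ] {k g : ℝ → ℝ}
    (hk : IsMode k μ) (hg : MemLp g 2 μ) : MemLp (modeResidual μ k g) 2 μ :=
  (hg.sub (memLp_const _)).sub (hk.memLp.mul_const _)

theorem integral_modeResidual_sq {μ : Measure ℝ} [IsProbabilityMeasure μ] {k g : ℝ → ℝ}
    (hk : IsMode k μ) (hg : MemLp g 2 μ) :
    ∫ s, modeResidual μ k g s ^ 2 ∂μ
      = ∫ s, g s ^ 2 ∂μ - (∫ s, g s ∂μ) ^ 2 - (∫ s, k s * g s ∂μ) ^ 2 := by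
  have i1 : Integrable g μ := hg.integrable (by norm_num)
  have i2 : Integrable k μ := hk.memLp.integrable (by norm_num)
  have i3 : Integrable (fun s => g s ^ 2) μ := hg.integrable_sq
  have i4 : Integrable (fun s => k s ^ 2) μ := hk.memLp.integrable_sq
  have i5 : Integrable (fun s => k s * g s) μ := hk.memLp.integrable_mul hg
  have hq : (∫ t, k t ^ 2 ∂μ) * (∫ s, k s * g s ∂μ) ^ 2 = (∫ s, k s * g s ∂μ) ^ 2 := by
    rcases hk.unit_or_zero with h | h
    · rw [h, one_mul]
    · simp [h]
  simp only [modeResidual]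
  set a := ∫ t, g t ∂μ
  set q := ∫ t, k t * g t ∂μ
  have e : ∀ s, (g s - a - k s * q) ^ 2 = g s ^ 2 + a ^ 2 + q ^ 2 * k s ^ 2 - 2 * a * g s
      - 2 * q * (k s * g s) + 2 * a * q * k s := fun s => by ring
  simp only [e]
  rw [integral_add (by fun_prop) (by fun_prop), integral_sub (by fun_prop) (by fun_prop),
    integral_sub (by fun_prop) (by fun_prop), integral_add (by fun_prop) (by fun_prop),
    integral_add i3 (by fun_prop), integral_const_mul, integral_const_mul,
    integral_const_mul, integral_const_mul, hk.integral_eq_zero]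
  simp only [integral_const, probReal_univ, one_smul]
  change _ + a ^ 2 + _ - 2 * a * a - 2 * q * q + _ = _
  linarith

theorem bessel_mode {μ : Measure ℝ} [IsProbabilityMeasure μ] {k g : ℝ → ℝ}
    (hk : IsMode k μ) (hg : MemLp g 2 μ) :
    (∫ s, g s ∂μ) ^ 2 + (∫ s, k s * g s ∂μ) ^ 2 ≤ ∫ s, g s ^ 2 ∂μ := by
  have h := integral_modeResidual_sq hk hg
  have : 0 ≤ ∫ s, modeResidual μ k g s ^ 2 ∂μ := integral_nonneg fun s => sq_nonneg _
  linarith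

/-- The residual of `f` in the `i`-th variable. -/
noncomputable def coordResidual {n : ℕ} (μ : Fin n → Measure ℝ) (i : Fin n) (k : ℝ → ℝ)
    (f : (Fin n → ℝ) → ℝ) (x : Fin n → ℝ) : ℝ :=
  modeResidual (μ i) k (fun t => f (Function.update x i t)) (x i)

theorem memLp_two_of_bounded {X : Type*} [MeasurableSpace X] {μ : Measure X} [IsFiniteMeasure μ]
    {g : X → ℝ} (hg : Measurable g) {C : ℝ} (hC : ∀ x, |g x| ≤ C) : MemLp g 2 μ :=
  MemLp.of_bound hg.aestronglyMeasurable C (Filter.Eventually.of_forall hC)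

theorem integrable_of_bounded {X : Type*} [MeasurableSpace X] {μ : Measure X} [IsFiniteMeasure μ]
    {g : X → ℝ} (hg : Measurable g) {C : ℝ} (hC : ∀ x, |g x| ≤ C) : Integrable g μ :=
  Integrable.of_bound hg.aestronglyMeasurable C (Filter.Eventually.of_forall hC)

theorem abs_integral_mul_le {X : Type*} [MeasurableSpace X] {μ : Measure X} {k g : X → ℝ} {C : ℝ}
    (hk : Integrable k μ) (hC : ∀ x, |g x| ≤ C) :
    |∫ x, k x * g x ∂μ| ≤ (∫ x, |k x| ∂μ) * C := by
  rw [← integral_mul_const]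
  refine norm_integral_le_of_norm_le (f := fun x => k x * g x) (hk.abs.mul_const C)
    (Filter.Eventually.of_forall fun x => ?_)
  rw [norm_mul, Real.norm_eq_abs, Real.norm_eq_abs]
  exact mul_le_mul_of_nonneg_left (hC x) (abs_nonneg _)

theorem abs_integral_le_of_bounded {X : Type*} [MeasurableSpace X] {μ : Measure X}
    [IsProbabilityMeasure μ] {g : X → ℝ} {C : ℝ} (hC : ∀ x, |g x| ≤ C) : |∫ x, g x ∂μ| ≤ C := by
  simpa using norm_integral_le_of_norm_le_const (μ := μ) (f := g) (Filter.Eventually.of_forall hC)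

theorem integral_sub_sub_const_mul {X : Type*} [MeasurableSpace X] {μ : Measure X} {a b c : X → ℝ}
    (ha : Integrable a μ) (hb : Integrable b μ) (hc : Integrable c μ) (r : ℝ) :
    ∫ x, (a x - b x - r * c x) ∂μ = ∫ x, a x ∂μ - ∫ x, b x ∂μ - r * ∫ x, c x ∂μ := by
  rw [integral_sub (by fun_prop) (by fun_prop), integral_sub ha hb, integral_const_mul]

section Fibers

variable {n : ℕ} {μ : Fin n → Measure ℝ} [∀ i, IsProbabilityMeasure (μ i)]

theorem measurable_coordResidual {Z : Type*} [MeasurableSpace Z] (i : Fin n) {k : ℝ → ℝ}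
    (hk : Measurable k) {f : Z → (Fin n → ℝ) → ℝ} (hf : Measurable fun p : Z × (Fin n → ℝ) => f p.1 p.2) :
    Measurable fun p : Z × (Fin n → ℝ) => coordResidual μ i k (f p.1) p.2 := by
  have hu : Measurable fun q : (Z × (Fin n → ℝ)) × ℝ => f q.1.1 (Function.update q.1.2 i q.2) :=
    hf.comp ((measurable_fst.comp measurable_fst).prodMk
      (measurable_update'.comp ((measurable_snd.comp measurable_fst).prodMk measurable_snd)))
  have h1 : Measurable fun p : Z × (Fin n → ℝ) => ∫ t, f p.1 (Function.update p.2 i t) ∂(μ i) :=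
    hu.stronglyMeasurable.integral_prod_right'.measurable
  have h2 : Measurable fun p : Z × (Fin n → ℝ) =>
      ∫ t, k t * f p.1 (Function.update p.2 i t) ∂(μ i) :=
    ((hk.comp measurable_snd).mul hu).stronglyMeasurable.integral_prod_right'.measurable
  have h3 : Measurable fun p : Z × (Fin n → ℝ) => k (p.2 i) := by fun_prop
  simp only [coordResidual, modeResidual, Function.update_eq_self]
  exact (hf.sub h1).sub (h3.mul h2)

theorem abs_coordResidual_le (i : Fin n) {k : ℝ → ℝ} (hk : IsMode k (μ i))
    {f : (Fin n → ℝ) → ℝ} {C : ℝ} (hC : ∀ x, |f x| ≤ C) (x : Fin n → ℝ) :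
    |coordResidual μ i k f x| ≤ C + C + |k (x i)| * ((∫ t, |k t| ∂(μ i)) * C) := by
  simp only [coordResidual, modeResidual, Function.update_eq_self]
  refine (abs_sub _ _).trans (add_le_add ((abs_sub _ _).trans (add_le_add (hC x) ?_)) ?_)
  · exact abs_integral_le_of_bounded fun t => hC _
  · rw [abs_mul]
    exact mul_le_mul_of_nonneg_left
      (abs_integral_mul_le (hk.memLp.integrable (by norm_num)) fun t => hC _) (abs_nonneg _)

theorem memLp_coord (i : Fin n) {k : ℝ → ℝ} (hk : MemLp k 2 (μ i)) :
    MemLp (fun x : Fin n → ℝ => k (x i)) 2 (Measure.pi μ) :=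
  hk.comp_measurePreserving (measurePreserving_eval μ i)

theorem memLp_residualBound (i : Fin n) {k : ℝ → ℝ} (hk : IsMode k (μ i)) (a b : ℝ) :
    MemLp (fun x : Fin n → ℝ => a + |k (x i)| * b) 2 (Measure.pi μ) :=
  (memLp_const a).add ((memLp_coord i hk.memLp).abs.mul_const b)

theorem integrable_coordResidual_sq (i : Fin n) {k : ℝ → ℝ} (hk : IsMode k (μ i))
    {g : (Fin n → ℝ) → ℝ} {C : ℝ} (hg : Measurable g) (hC : ∀ x, |g x| ≤ C) :
    Integrable (fun x => coordResidual μ i k g x ^ 2) (Measure.pi μ) := by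
  have hm : Measurable fun x => coordResidual μ i k g x :=
    (measurable_coordResidual (μ := μ) (Z := Unit) (f := fun _ => g) i hk.measurable
      (hg.comp measurable_snd)).comp (measurable_const.prodMk measurable_id : Measurable
        fun x : Fin n → ℝ => ((), x))
  refine (((memLp_residualBound i hk (C + C) ((∫ t, |k t| ∂(μ i)) * C)).mono
    hm.aestronglyMeasurable (Filter.Eventually.of_forall fun x => ?_))).integrable_sq
  exact (abs_coordResidual_le i hk hC x).trans (le_abs_self _)

/-- Bessel's inequality in an auxiliary variable for the coordinate residuals. -/
theorem coordResidual_bessel {ν : Measure ℝ} [IsProbabilityMeasure ν] {h : ℝ → ℝ}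
    (hh : IsMode h ν) (i : Fin n) {k : ℝ → ℝ} (hk : IsMode k (μ i))
    {f : ℝ → (Fin n → ℝ) → ℝ} (hf : Measurable fun p : ℝ × (Fin n → ℝ) => f p.1 p.2) {C : ℝ}
    (hC : ∀ s x, |f s x| ≤ C) :
    ∫ x, coordResidual μ i k (fun y => ∫ s, f s y ∂ν) x ^ 2 ∂(Measure.pi μ)
      + ∫ x, coordResidual μ i k (fun y => ∫ s, h s * f s y ∂ν) x ^ 2 ∂(Measure.pi μ)
      ≤ ∫ s, ∫ x, coordResidual μ i k (f s) x ^ 2 ∂(Measure.pi μ) ∂ν := by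
  have ik : Integrable k (μ i) := hk.memLp.integrable (by norm_num)
  have ih : Integrable h ν := hh.memLp.integrable (by norm_num)
  set F : (Fin n → ℝ) → ℝ := fun y => ∫ s, f s y ∂ν with hF
  set G : (Fin n → ℝ) → ℝ := fun y => ∫ s, h s * f s y ∂ν with hG
  have hfs : Measurable fun p : (Fin n → ℝ) × ℝ => f p.2 p.1 := hf.comp measurable_swap
  have Fm : Measurable F := hfs.stronglyMeasurable.integral_prod_right'.measurable
  have Gm : Measurable G := ((hh.measurable.comp measurable_snd).mul
    hfs).stronglyMeasurable.integral_prod_right'.measurable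
  have FC : ∀ y, |F y| ≤ C := fun y => abs_integral_le_of_bounded fun s => hC s y
  have GC : ∀ y, |G y| ≤ (∫ s, |h s| ∂ν) * C := fun y => abs_integral_mul_le ih fun s => hC s y
  have fm : ∀ x, Measurable fun s => f s x := fun x => hf.comp measurable_prodMk_right
  have key : ∀ x, coordResidual μ i k F x = ∫ s, coordResidual μ i k (f s) x ∂ν ∧
      coordResidual μ i k G x = ∫ s, h s * coordResidual μ i k (f s) x ∂ν := by
    intro x
    have um : Measurable fun q : ℝ × ℝ => f q.1 (Function.update x i q.2) :=
      hf.comp (measurable_fst.prodMk ((measurable_update x).comp measurable_snd))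
    have iu : Integrable (fun q : ℝ × ℝ => f q.1 (Function.update x i q.2)) (ν.prod (μ i)) :=
      integrable_of_bounded um fun q => hC _ _
    have bd : ∀ {l : ℝ × ℝ → ℝ}, Integrable l (ν.prod (μ i)) →
        Integrable (fun q : ℝ × ℝ => l q * f q.1 (Function.update x i q.2)) (ν.prod (μ i)) :=
      fun hl => hl.mul_bdd um.aestronglyMeasurable (Filter.Eventually.of_forall fun q => hC _ _)
    have i1 : Integrable (fun q : ℝ × ℝ => h q.1 * f q.1 (Function.update x i q.2))
        (ν.prod (μ i)) := bd (ih.comp_fst _)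
    have i2 : Integrable (fun q : ℝ × ℝ => k q.2 * f q.1 (Function.update x i q.2))
        (ν.prod (μ i)) := bd (ik.comp_snd _)
    have i3 : Integrable (fun q : ℝ × ℝ => (h q.1 * k q.2) * f q.1 (Function.update x i q.2))
        (ν.prod (μ i)) := bd (ih.mul_prod ik)
    have i3' : Integrable (fun q : ℝ × ℝ => h q.1 * (k q.2 * f q.1 (Function.update x i q.2)))
        (ν.prod (μ i)) := by simpa only [mul_assoc] using i3
    have b1 : Integrable (fun s => f s x) ν := integrable_of_bounded (fm x) fun s => hC s x
    have b2 : Integrable (fun s => h s * f s x) ν :=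
      ih.mul_bdd (fm x).aestronglyMeasurable (Filter.Eventually.of_forall fun s => hC s x)
    simp only [coordResidual, modeResidual, Function.update_eq_self, hF, hG]
    constructor
    · rw [integral_sub_sub_const_mul b1 iu.integral_prod_left i2.integral_prod_left,
        integral_integral_swap (f := fun s t => f s (Function.update x i t)) iu,
        integral_integral_swap (f := fun s t => k t * f s (Function.update x i t)) i2]
      simp only [integral_const_mul]
    · have e : ∀ s, h s * (f s x - ∫ t, f s (Function.update x i t) ∂(μ i)
            - k (x i) * ∫ t, k t * f s (Function.update x i t) ∂(μ i))
          = h s * f s x - ∫ t, h s * f s (Function.update x i t) ∂(μ i)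
            - k (x i) * ∫ t, h s * (k t * f s (Function.update x i t)) ∂(μ i) := fun s => by
        rw [integral_const_mul, integral_const_mul]; ring
      simp only [e]
      rw [integral_sub_sub_const_mul b2 i1.integral_prod_left i3'.integral_prod_left,
        integral_integral_swap (f := fun s t => h s * f s (Function.update x i t)) i1,
        integral_integral_swap (f := fun s t => h s * (k t * f s (Function.update x i t))) i3']
      congr 2
      refine integral_congr_ae (Filter.Eventually.of_forall fun t => ?_)
      simp only
      rw [← integral_const_mul]
      exact integral_congr_ae (Filter.Eventually.of_forall fun s => by simp only; ring)
  have Rm := measurable_coordResidual (μ := μ) i hk.measurable hf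
  have Ri : Integrable (fun p : ℝ × (Fin n → ℝ) => coordResidual μ i k (f p.1) p.2 ^ 2)
      (ν.prod (Measure.pi μ)) := by
    have hb : MemLp (fun p : ℝ × (Fin n → ℝ) =>
        C + C + |k (p.2 i)| * ((∫ t, |k t| ∂(μ i)) * C)) 2 (ν.prod (Measure.pi μ)) :=
      (memLp_residualBound i hk (C + C) ((∫ t, |k t| ∂(μ i)) * C)).comp_measurePreserving
        measurePreserving_snd
    refine (hb.mono Rm.aestronglyMeasurable (Filter.Eventually.of_forall fun p => ?_)).integrable_sq
    exact (abs_coordResidual_le i hk (hC p.1) p.2).trans (le_abs_self _)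
  rw [integral_integral_swap (f := fun s x => coordResidual μ i k (f s) x ^ 2) Ri,
    ← integral_add (integrable_coordResidual_sq i hk Fm FC) (integrable_coordResidual_sq i hk Gm GC)]
  refine integral_mono ((integrable_coordResidual_sq i hk Fm FC).add
    (integrable_coordResidual_sq i hk Gm GC)) Ri.integral_prod_right fun x => ?_
  have := bessel_mode (g := fun s => coordResidual μ i k (f s) x) hh
    (memLp_two_of_bounded (Rm.comp (measurable_prodMk_right (y := x)))
      fun s => abs_coordResidual_le i hk (hC s) x)
  rw [(key x).1, (key x).2]
  exact this

/-- The quadratic form dominated by the one-dimensional energy in the `i`-th variable. -/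
noncomputable def coordForm {n : ℕ} (μ : Fin n → Measure ℝ) (i : Fin n) (k : ℝ → ℝ)
    (f : (Fin n → ℝ) → ℝ) : ℝ :=
  ∫ x, coordResidual μ i (fun _ => 0) f x ^ 2 ∂(Measure.pi μ)
    + ∫ x, coordResidual μ i k f x ^ 2 ∂(Measure.pi μ)

theorem integral_sub_modes_sq {h : Fin n → ℝ → ℝ} (hh : ∀ i, IsMode (h i) (μ i))
    {f : (Fin n → ℝ) → ℝ} (hf : MemLp f 2 (Measure.pi μ)) :
    ∫ x, (f x - ∫ y, f y ∂(Measure.pi μ)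
        - ∑ i, (∫ y, h i (y i) * f y ∂(Measure.pi μ)) * h i (x i)) ^ 2 ∂(Measure.pi μ)
      = ∫ x, f x ^ 2 ∂(Measure.pi μ) - (∫ x, f x ∂(Measure.pi μ)) ^ 2
        - ∑ i, (∫ x, h i (x i) * f x ∂(Measure.pi μ)) ^ 2 := by
  set m := ∫ y, f y ∂(Measure.pi μ) with hm
  set q : Fin n → ℝ := fun i => ∫ y, h i (y i) * f y ∂(Measure.pi μ) with hq
  change ∫ x, (f x - m - ∑ i, q i * h i (x i)) ^ 2 ∂(Measure.pi μ) = _ - ∑ i, q i ^ 2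
  have hL : ∀ i, MemLp (fun x : Fin n → ℝ => q i * h i (x i)) 2 (Measure.pi μ) :=
    fun i => (memLp_coord i (hh i).memLp).const_mul (q i)
  have hS : MemLp (fun x : Fin n → ℝ => ∑ i, q i * h i (x i)) 2 (Measure.pi μ) :=
    memLp_finsetSum _ fun i _ => hL i
  have S1 : ∫ x : Fin n → ℝ, ∑ i, q i * h i (x i) ∂(Measure.pi μ) = 0 := by
    rw [integral_finsetSum _ fun i _ => (hL i).integrable (by norm_num)]
    refine Finset.sum_eq_zero fun i _ => ?_
    rw [integral_const_mul, integral_comp_eval (hh i).memLp.1, (hh i).integral_eq_zero, mul_zero]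
  have S2 : ∫ x : Fin n → ℝ, (∑ i, q i * h i (x i)) ^ 2 ∂(Measure.pi μ) = ∑ i, q i ^ 2 := by
    have hv := ProbabilityTheory.variance_sum_pi (μ := μ) (X := fun i t => q i * h i t)
      fun i => (hh i).memLp.const_mul (q i)
    rw [ProbabilityTheory.variance_of_integral_eq_zero] at hv
    · simp only [Finset.sum_apply] at hv
      rw [hv]
      refine Finset.sum_congr rfl fun i _ => ?_
      rw [ProbabilityTheory.variance_of_integral_eq_zero
        ((hh i).measurable.const_mul _).aemeasurable
        (by rw [integral_const_mul, (hh i).integral_eq_zero, mul_zero])]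
      simp only [mul_pow]
      rw [integral_const_mul]
      rcases (hh i).unit_or_zero with h1 | h1
      · rw [h1, mul_one]
      · simp [hq, h1]
    · simpa only [Finset.sum_fn] using hS.1.aemeasurable
    · simpa only [Finset.sum_apply] using S1
  have S3 : ∫ x : Fin n → ℝ, f x * ∑ i, q i * h i (x i) ∂(Measure.pi μ) = ∑ i, q i ^ 2 := by
    have i0 : ∀ i, Integrable (fun x => f x * (q i * h i (x i))) (Measure.pi μ) :=
      fun i => hf.integrable_mul (hL i)
    simp only [Finset.mul_sum]
    rw [integral_finsetSum _ fun i _ => i0 i]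
    refine Finset.sum_congr rfl fun i _ => ?_
    rw [pow_two, ← integral_const_mul]
    exact integral_congr_ae (Filter.Eventually.of_forall fun x => by simp only; ring)
  set S : (Fin n → ℝ) → ℝ := fun x => ∑ i, q i * h i (x i) with hSdef
  have i1 : Integrable f (Measure.pi μ) := hf.integrable (by norm_num)
  have i2 : Integrable S (Measure.pi μ) := hS.integrable (by norm_num)
  have i3 : Integrable (fun x => f x ^ 2) (Measure.pi μ) := hf.integrable_sq
  have i4 : Integrable (fun x => S x ^ 2) (Measure.pi μ) := hS.integrable_sq
  have i5 : Integrable (fun x => f x * S x) (Measure.pi μ) := hf.integrable_mul hS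
  have e : ∀ x, (f x - m - S x) ^ 2 = f x ^ 2 + m ^ 2 + S x ^ 2 - 2 * m * f x - 2 * (f x * S x)
      + 2 * m * S x := fun x => by ring
  change ∫ x, (f x - m - S x) ^ 2 ∂(Measure.pi μ) = _
  simp only [e]
  rw [integral_add (by fun_prop) (by fun_prop), integral_sub (by fun_prop) (by fun_prop),
    integral_sub (by fun_prop) (by fun_prop), integral_add (by fun_prop) (by fun_prop),
    integral_add i3 (by fun_prop), integral_const_mul, integral_const_mul, integral_const_mul,
    S1, S2, S3, ← hm]
  simp only [integral_const, probReal_univ, one_smul]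
  ring

theorem bessel_modes {h : Fin n → ℝ → ℝ} (hh : ∀ i, IsMode (h i) (μ i))
    {f : (Fin n → ℝ) → ℝ} (hf : MemLp f 2 (Measure.pi μ)) :
    ∑ i, (∫ x, h i (x i) * f x ∂(Measure.pi μ)) ^ 2
      ≤ ∫ x, f x ^ 2 ∂(Measure.pi μ) - (∫ x, f x ∂(Measure.pi μ)) ^ 2 := by
  have h1 := integral_sub_modes_sq hh hf
  have h2 : 0 ≤ ∫ x, (f x - ∫ y, f y ∂(Measure.pi μ)
      - ∑ i, (∫ y, h i (y i) * f y ∂(Measure.pi μ)) * h i (x i)) ^ 2 ∂(Measure.pi μ) :=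
    integral_nonneg fun x => sq_nonneg _
  linarith

end Fibers

section Tensorization

theorem measurePreserving_cons {n : ℕ} (μ : Fin (n + 1) → Measure ℝ)
    [∀ i, IsProbabilityMeasure (μ i)] :
    MeasurePreserving (fun p : ℝ × (Fin n → ℝ) => (Fin.cons p.1 p.2 : Fin (n + 1) → ℝ))
      ((μ 0).prod (Measure.pi fun j => μ j.succ)) (Measure.pi μ) := by
  have h := (measurePreserving_piFinSuccAbove μ 0).symm
  simpa [MeasurableEquiv.piFinSuccAbove_symm_apply, Fin.insertNthEquiv, Fin.insertNth_zero'] using h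

theorem integral_pi_cons {n : ℕ} {μ : Fin (n + 1) → Measure ℝ} [∀ i, IsProbabilityMeasure (μ i)]
    (g : (Fin (n + 1) → ℝ) → ℝ) :
    ∫ x, g x ∂(Measure.pi μ)
      = ∫ p, g (Fin.cons p.1 p.2) ∂((μ 0).prod (Measure.pi fun j => μ j.succ)) := by
  have h := (measurePreserving_piFinSuccAbove μ 0).symm
  rw [← h.integral_comp']
  simp [MeasurableEquiv.piFinSuccAbove_symm_apply, Fin.insertNthEquiv, Fin.insertNth_zero']

theorem coordForm_zero {n : ℕ} {μ : Fin (n + 1) → Measure ℝ} [∀ i, IsProbabilityMeasure (μ i)]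
    {k : ℝ → ℝ} (hk : IsMode k (μ 0)) {f : (Fin (n + 1) → ℝ) → ℝ} (hf : Measurable f) {C : ℝ}
    (hC : ∀ x, |f x| ≤ C) :
    coordForm μ 0 k f = 2 * ∫ x, f x ^ 2 ∂(Measure.pi μ)
      - 2 * ∫ y, (∫ s, f (Fin.cons s y) ∂(μ 0)) ^ 2 ∂(Measure.pi fun j => μ j.succ)
      - ∫ y, (∫ s, k s * f (Fin.cons s y) ∂(μ 0)) ^ 2 ∂(Measure.pi fun j => μ j.succ) := by
  set ν := Measure.pi fun j : Fin n => μ j.succ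
  have hfc : Measurable fun p : ℝ × (Fin n → ℝ) => f (Fin.cons p.1 p.2) :=
    hf.comp (measurePreserving_cons μ).measurable
  have hfc' : Measurable fun p : (Fin n → ℝ) × ℝ => f (Fin.cons p.2 p.1) :=
    hfc.comp measurable_swap
  have hL : ∀ y, MemLp (fun s => f (Fin.cons s y)) 2 (μ 0) := fun y =>
    memLp_two_of_bounded (hfc.comp (measurable_prodMk_right (y := y))) fun s => hC _
  have ik : Integrable k (μ 0) := hk.memLp.integrable (by norm_num)
  have isq : Integrable (fun p : ℝ × (Fin n → ℝ) => f (Fin.cons p.1 p.2) ^ 2) ((μ 0).prod ν) :=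
    (memLp_two_of_bounded hfc fun p => hC _).integrable_sq
  have iF : Integrable (fun y => (∫ s, f (Fin.cons s y) ∂(μ 0)) ^ 2) ν :=
    (memLp_two_of_bounded hfc'.stronglyMeasurable.integral_prod_right'.measurable
      fun y => abs_integral_le_of_bounded fun s => hC _).integrable_sq
  have iG : Integrable (fun y => (∫ s, k s * f (Fin.cons s y) ∂(μ 0)) ^ 2) ν :=
    (memLp_two_of_bounded ((hk.measurable.comp measurable_snd).mul
      hfc').stronglyMeasurable.integral_prod_right'.measurable
      fun y => abs_integral_mul_le ik fun s => hC _).integrable_sq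
  have aux : ∀ l : ℝ → ℝ, IsMode l (μ 0) →
      ∫ x, coordResidual μ 0 l f x ^ 2 ∂(Measure.pi μ)
        = ∫ y, (∫ s, f (Fin.cons s y) ^ 2 ∂(μ 0) - (∫ s, f (Fin.cons s y) ∂(μ 0)) ^ 2
          - (∫ s, l s * f (Fin.cons s y) ∂(μ 0)) ^ 2) ∂ν := by
    intro l hl
    have hi := (measurePreserving_cons μ).integrable_comp_of_integrable
      (integrable_coordResidual_sq (μ := μ) 0 hl hf hC)
    rw [integral_pi_cons, integral_prod_symm (fun p => coordResidual μ 0 l f (Fin.cons p.1 p.2) ^ 2) hi]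
    refine integral_congr_ae (Filter.Eventually.of_forall fun y => ?_)
    simp only
    rw [← integral_modeResidual_sq hl (hL y)]
    simp only [coordResidual, Fin.update_cons_zero, Fin.cons_zero]
  rw [coordForm, aux _ (isMode_zero _), aux _ hk, integral_pi_cons (μ := μ) (fun x => f x ^ 2),
    integral_prod_symm _ isq]
  have i0 : Integrable (fun y => ∫ s, f (Fin.cons s y) ^ 2 ∂(μ 0)) ν := isq.integral_prod_right
  simp only [zero_mul, integral_zero, zero_pow (two_ne_zero), sub_zero]
  rw [integral_sub i0 iF, integral_sub (by fun_prop) iG, integral_sub i0 iF]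
  ring

theorem coordForm_succ_ge {n : ℕ} {μ : Fin (n + 1) → Measure ℝ} [∀ i, IsProbabilityMeasure (μ i)]
    {h : ℝ → ℝ} (hh : IsMode h (μ 0)) (j : Fin n) {k : ℝ → ℝ} (hk : IsMode k (μ j.succ))
    {f : (Fin (n + 1) → ℝ) → ℝ} (hf : Measurable f) {C : ℝ} (hC : ∀ x, |f x| ≤ C) :
    coordForm (fun j => μ j.succ) j k (fun y => ∫ s, f (Fin.cons s y) ∂(μ 0))
      + coordForm (fun j => μ j.succ) j k (fun y => ∫ s, h s * f (Fin.cons s y) ∂(μ 0))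
      ≤ coordForm μ j.succ k f := by
  have hfc : Measurable fun p : ℝ × (Fin n → ℝ) => f (Fin.cons p.1 p.2) :=
    hf.comp (measurePreserving_cons μ).measurable
  have aux : ∀ l : ℝ → ℝ, IsMode l (μ j.succ) →
      ∫ x, coordResidual (fun j => μ j.succ) j l (fun y => ∫ s, f (Fin.cons s y) ∂(μ 0)) x ^ 2
          ∂(Measure.pi fun j => μ j.succ)
        + ∫ x, coordResidual (fun j => μ j.succ) j l
          (fun y => ∫ s, h s * f (Fin.cons s y) ∂(μ 0)) x ^ 2 ∂(Measure.pi fun j => μ j.succ)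
        ≤ ∫ x, coordResidual μ j.succ l f x ^ 2 ∂(Measure.pi μ) := by
    intro l hl
    have hi := (measurePreserving_cons μ).integrable_comp_of_integrable
      (integrable_coordResidual_sq (μ := μ) j.succ hl hf hC)
    rw [integral_pi_cons, integral_prod (fun p => coordResidual μ j.succ l f (Fin.cons p.1 p.2) ^ 2) hi]
    refine (coordResidual_bessel (μ := fun j => μ j.succ) hh j hl
      (f := fun s y => f (Fin.cons s y)) hfc fun s y => hC _).trans (le_of_eq ?_)
    simp only [coordResidual, Fin.cons_update, Fin.cons_succ]
  have h1 := aux _ (isMode_zero _)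
  have h2 := aux _ hk
  simp only [coordForm]
  linarith

/-- The sharpened Efron-Stein inequality for a product of probability measures with modes. -/
theorem sum_coordForm_ge {n : ℕ} (μ : Fin n → Measure ℝ) [∀ i, IsProbabilityMeasure (μ i)]
    {h : Fin n → ℝ → ℝ} (hh : ∀ i, IsMode (h i) (μ i))
    {f : (Fin n → ℝ) → ℝ} (hf : Measurable f) {C : ℝ} (hC : ∀ x, |f x| ≤ C) :
    2 * (∫ x, f x ^ 2 ∂(Measure.pi μ) - (∫ x, f x ∂(Measure.pi μ)) ^ 2)
        - ∑ i, (∫ x, h i (x i) * f x ∂(Measure.pi μ)) ^ 2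
      ≤ ∑ i, coordForm μ i (h i) f := by
  induction n generalizing C with
  | zero =>
    have e : ∀ x, f x = f default := fun x => congrArg f (Subsingleton.elim _ _)
    simp [e]
  | succ n ih =>
    set ν := Measure.pi fun j : Fin n => μ j.succ
    have hfc : Measurable fun p : ℝ × (Fin n → ℝ) => f (Fin.cons p.1 p.2) :=
      hf.comp (measurePreserving_cons μ).measurable
    have hfc' : Measurable fun p : (Fin n → ℝ) × ℝ => f (Fin.cons p.2 p.1) :=
      hfc.comp measurable_swap
    have i0 : Integrable (h 0) (μ 0) := (hh 0).memLp.integrable (by norm_num)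
    have ip : Integrable (fun p : ℝ × (Fin n → ℝ) => f (Fin.cons p.1 p.2)) ((μ 0).prod ν) :=
      integrable_of_bounded hfc fun p => hC _
    have bd : ∀ {l : ℝ × (Fin n → ℝ) → ℝ}, Integrable l ((μ 0).prod ν) →
        Integrable (fun p => l p * f (Fin.cons p.1 p.2)) ((μ 0).prod ν) :=
      fun hl => hl.mul_bdd hfc.aestronglyMeasurable (Filter.Eventually.of_forall fun q => hC _)
    set F : (Fin n → ℝ) → ℝ := fun y => ∫ s, f (Fin.cons s y) ∂(μ 0) with hF
    set G : (Fin n → ℝ) → ℝ := fun y => ∫ s, h 0 s * f (Fin.cons s y) ∂(μ 0) with hG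
    have Fm : Measurable F := hfc'.stronglyMeasurable.integral_prod_right'.measurable
    have Gm : Measurable G := (((hh 0).measurable.comp measurable_snd).mul
      hfc').stronglyMeasurable.integral_prod_right'.measurable
    have FC : ∀ y, |F y| ≤ C := fun y => abs_integral_le_of_bounded fun s => hC _
    have GC : ∀ y, |G y| ≤ (∫ s, |h 0 s| ∂(μ 0)) * C :=
      fun y => abs_integral_mul_le i0 fun s => hC _
    have e1 : ∫ x, f x ∂(Measure.pi μ) = ∫ y, F y ∂ν := by
      rw [integral_pi_cons, integral_prod_symm _ ip]
    have e2 : ∫ x, h 0 (x 0) * f x ∂(Measure.pi μ) = ∫ y, G y ∂ν := by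
      rw [integral_pi_cons]
      simp only [Fin.cons_zero]
      rw [integral_prod_symm _ (bd (i0.comp_fst _))]
    have e3 : ∀ j : Fin n, ∫ x, h j.succ (x j.succ) * f x ∂(Measure.pi μ)
        = ∫ y, h j.succ (y j) * F y ∂ν := by
      intro j
      have ij : Integrable (fun y : Fin n → ℝ => h j.succ (y j)) ν :=
        (memLp_coord (μ := fun j => μ j.succ) j (hh j.succ).memLp).integrable (by norm_num)
      rw [integral_pi_cons]
      simp only [Fin.cons_succ]
      rw [integral_prod_symm _ (bd (ij.comp_snd _))]
      simp only [integral_const_mul, hF]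
    have h1 := ih (fun j => μ j.succ) (h := fun j => h j.succ) (fun j => hh j.succ) Fm FC
    have h2 := ih (fun j => μ j.succ) (h := fun j => h j.succ) (fun j => hh j.succ) Gm GC
    have h3 := bessel_modes (μ := fun j => μ j.succ) (h := fun j => h j.succ)
      (fun j => hh j.succ) (memLp_two_of_bounded Gm GC)
    have h4 := Finset.sum_le_sum fun (j : Fin n) (_ : j ∈ Finset.univ) =>
      coordForm_succ_ge (hh 0) j (hh j.succ) hf hC
    rw [Finset.sum_add_distrib] at h4
    have h5 := coordForm_zero (hh 0) hf hC
    rw [Fin.sum_univ_succ, Fin.sum_univ_succ, e1, e2, h5]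
    simp only [e3]
    linarith

theorem integral_integral_update {n : ℕ} {μ : Fin n → Measure ℝ} [∀ i, IsProbabilityMeasure (μ i)]
    (i : Fin n) {g : (Fin n → ℝ) → ℝ} (hg : Integrable g (Measure.pi μ)) :
    ∫ x, ∫ t, g (Function.update x i t) ∂(μ i) ∂(Measure.pi μ) = ∫ x, g x ∂(Measure.pi μ) := by
  obtain _ | n := n
  · exact i.elim0
  have h := (measurePreserving_piFinSuccAbove μ i).symm
  have ip : Integrable (fun p : ℝ × (Fin n → ℝ) => g (i.insertNth p.1 p.2))
      ((μ i).prod (Measure.pi fun j => μ (i.succAbove j))) :=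
    h.integrable_comp_of_integrable hg
  rw [← h.integral_comp' (g := g), ← h.integral_comp']
  simp only [MeasurableEquiv.piFinSuccAbove_symm_apply, Fin.insertNthEquiv, Equiv.coe_fn_mk,
    Fin.update_insertNth]
  rw [integral_prod_symm _ ip,
    integral_fun_snd (fun y => ∫ t, g (i.insertNth t y) ∂(μ i))]
  simp

/-- Tensorization of one-dimensional second-order Poincaré inequalities. -/
theorem tensorized_poincare {n : ℕ} (μ : Fin n → Measure ℝ) [∀ i, IsProbabilityMeasure (μ i)]
    {h : Fin n → ℝ → ℝ} (hh : ∀ i, IsMode (h i) (μ i))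
    {f : (Fin n → ℝ) → ℝ} (hf : Measurable f) {C : ℝ} (hC : ∀ x, |f x| ≤ C)
    {g : Fin n → (Fin n → ℝ) → ℝ} (hg : ∀ i, Measurable (g i)) {D : ℝ} (hD : ∀ i x, |g i x| ≤ D)
    (hfg : ∀ i x, 2 * (∫ t, f (Function.update x i t) ^ 2 ∂(μ i)
          - (∫ t, f (Function.update x i t) ∂(μ i)) ^ 2)
        - (∫ t, h i t * f (Function.update x i t) ∂(μ i)) ^ 2
      ≤ ∫ t, g i (Function.update x i t) ∂(μ i)) :
    2 * (∫ x, f x ^ 2 ∂(Measure.pi μ) - (∫ x, f x ∂(Measure.pi μ)) ^ 2)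
        - ∑ i, (∫ x, h i (x i) * f x ∂(Measure.pi μ)) ^ 2
      ≤ ∑ i, ∫ x, g i x ∂(Measure.pi μ) := by
  refine (sum_coordForm_ge μ hh hf hC).trans (Finset.sum_le_sum fun i _ => ?_)
  have i1 := integrable_coordResidual_sq (μ := μ) i (isMode_zero (μ i)) hf hC
  have i2 := integrable_coordResidual_sq (μ := μ) i (hh i) hf hC
  have gm : Measurable fun x => ∫ t, g i (Function.update x i t) ∂(μ i) :=
    ((hg i).comp measurable_update').stronglyMeasurable.integral_prod_right'.measurable
  rw [coordForm, ← integral_add' i1 i2, ← integral_integral_update i (i1.add i2),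
    ← integral_integral_update i (integrable_of_bounded (hg i) (hD i))]
  refine integral_mono_of_nonneg (Filter.Eventually.of_forall fun x =>
      integral_nonneg fun t => add_nonneg (sq_nonneg _) (sq_nonneg _))
    (integrable_of_bounded gm fun x => abs_integral_le_of_bounded fun t => hD i _)
    (Filter.Eventually.of_forall fun x => (le_of_eq ?_).trans (hfg i x))
  have hL : MemLp (fun t => f (Function.update x i t)) 2 (μ i) :=
    memLp_two_of_bounded (hf.comp (measurable_update x)) fun t => hC _
  simp only [Pi.add_apply, coordResidual, Function.update_idem, Function.update_self]
  rw [integral_add (memLp_modeResidual (isMode_zero _) hL).integrable_sq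
    (memLp_modeResidual (hh i) hL).integrable_sq, integral_modeResidual_sq (isMode_zero _) hL,
    integral_modeResidual_sq (hh i) hL]
  simp only [zero_mul, integral_zero]
  ring

end Tensorization

/-- The one-dimensional factor `t ^ a * exp (-t² / (2 lam²))` of the weight. -/
noncomputable def coordDensity (a lam t : ℝ) : ℝ := t ^ a * Real.exp (-t ^ 2 / (2 * lam ^ 2))

theorem hasDerivAt_weighted_quotient {a lam t w' ρ' : ℝ} {ρ w : ℝ → ℝ} (ha : 0 ≤ a)
    (hlam : 0 < lam) (hρ : HasDerivAt ρ ρ' t) (hw : HasDerivAt w w' t) (hρ0 : 0 ≤ ρ t)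
    (hode : t * ρ' = (a - t ^ 2 / lam ^ 2) * ρ t)
    (hz : t ^ 2 = (a + 1) * lam ^ 2 → w t = 0) :
    ∃ d, HasDerivAt (fun s => ρ s * (2 * s) * w s ^ 2 / (s ^ 2 - (a + 1) * lam ^ 2)) d t ∧
      d ≤ ρ t * (w' ^ 2 - 2 / lam ^ 2 * w t ^ 2) := by
  by_cases ht : t ^ 2 = (a + 1) * lam ^ 2
  · have hw0 := hz ht
    have ht0 : t ≠ 0 := by
      rintro rfl
      have : 0 < (a + 1) * lam ^ 2 := by positivity
      rw [← ht] at this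
      norm_num at this
    refine ⟨ρ t * w' ^ 2, ?_, by simp [hw0]⟩
    rw [hasDerivAt_iff_tendsto_slope] at hw ⊢
    have hlim : Filter.Tendsto (fun s => ρ s * (2 * s) * slope w t s ^ 2 / (s + t))
        (nhdsWithin t {t}ᶜ) (nhds (ρ t * (2 * t) * w' ^ 2 / (t + t))) := by
      have h1 : Filter.Tendsto ρ (nhdsWithin t {t}ᶜ) (nhds (ρ t)) :=
        hρ.continuousAt.tendsto.mono_left nhdsWithin_le_nhds
      have h2 : Filter.Tendsto (fun s : ℝ => s) (nhdsWithin t {t}ᶜ) (nhds t) :=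
        Filter.tendsto_id.mono_left nhdsWithin_le_nhds
      exact ((h1.mul (h2.const_mul 2)).mul (hw.pow 2)).div (h2.add_const t)
        (by rw [← two_mul]; exact mul_ne_zero two_ne_zero ht0)
    have e : ρ t * (2 * t) * w' ^ 2 / (t + t) = ρ t * w' ^ 2 := by field_simp; ring
    rw [e] at hlim
    refine hlim.congr' ?_
    filter_upwards [self_mem_nhdsWithin] with s hs
    have hs' : s - t ≠ 0 := sub_ne_zero.mpr hs
    have h3 : s ^ 2 - (a + 1) * lam ^ 2 = (s - t) * (s + t) := by rw [← ht]; ring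
    rw [slope_def_field, slope_def_field, hw0, h3]
    by_cases h4 : s + t = 0
    · simp [h4]
    · field_simp
      ring
  · have hφ : t ^ 2 - (a + 1) * lam ^ 2 ≠ 0 := sub_ne_zero.mpr ht
    have h1 : HasDerivAt (fun s : ℝ => 2 * s) 2 t := by
      simpa using (hasDerivAt_id t).const_mul 2
    have h2 : HasDerivAt (fun s : ℝ => s ^ 2 - (a + 1) * lam ^ 2) (2 * t) t := by
      simpa using (hasDerivAt_pow 2 t).sub_const ((a + 1) * lam ^ 2)
    refine ⟨_, ((hρ.mul h1).mul (hw.pow 2)).div h2 hφ, ?_⟩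
    simp only [Pi.mul_apply, Pi.pow_apply]
    set φ := t ^ 2 - (a + 1) * lam ^ 2 with hφd
    have hl : lam ≠ 0 := hlam.ne'
    have h3 : ρ' * (2 * t) + ρ t * 2 = -(2 / lam ^ 2) * ρ t * φ := by
      have : ρ' * (2 * t) = 2 * ((a - t ^ 2 / lam ^ 2) * ρ t) := by rw [← hode]; ring
      rw [this, hφd]
      field_simp
      ring
    rw [h3]
    have h4 : 0 ≤ ρ t * (w' - 2 * t * w t / φ) ^ 2 := by positivity
    refine le_of_sub_nonneg (h4.trans (le_of_eq ?_))
    field_simp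
    ring

theorem coordDensity_nonneg {a lam t : ℝ} (ht : 0 < t ∨ a = 0) : 0 ≤ coordDensity a lam t := by
  rcases ht with h | rfl
  · exact mul_nonneg (Real.rpow_nonneg h.le _) (Real.exp_pos _).le
  · simpa [coordDensity] using (Real.exp_pos _).le

theorem hasDerivAt_coordDensity {a lam t : ℝ} (ht : 0 < t ∨ a = 0) :
    ∃ ρ', HasDerivAt (coordDensity a lam) ρ' t ∧
      t * ρ' = (a - t ^ 2 / lam ^ 2) * coordDensity a lam t := by
  have h1 : HasDerivAt (fun s : ℝ => Real.exp (-s ^ 2 / (2 * lam ^ 2)))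
      (Real.exp (-t ^ 2 / (2 * lam ^ 2)) * (-(2 * t) / (2 * lam ^ 2))) t := by
    have h2 : HasDerivAt (fun s : ℝ => s ^ 2) (2 * t) t := by simpa using hasDerivAt_pow 2 t
    exact (h2.neg.div_const _).exp
  have e : -(2 * t) / (2 * lam ^ 2) = -(t / lam ^ 2) := by
    rw [← mul_neg, mul_div_mul_left _ _ two_ne_zero, neg_div]
  rcases ht with h | rfl
  · refine ⟨_, (Real.hasDerivAt_rpow_const (p := a) (Or.inl h.ne')).mul h1, ?_⟩
    have h3 : t * t ^ (a - 1) = t ^ a := by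
      rw [Real.rpow_sub_one h.ne']; field_simp
    rw [e, coordDensity, mul_add, ← mul_assoc, ← mul_assoc, mul_comm t a, mul_assoc a, h3]
    ring
  · have e0 : coordDensity 0 lam = fun s => Real.exp (-s ^ 2 / (2 * lam ^ 2)) := by
      funext s; simp [coordDensity]
    refine ⟨_, e0 ▸ h1, ?_⟩
    rw [e, e0]
    ring

theorem exp_gauss_eq (lam t : ℝ) :
    Real.exp (-t ^ 2 / (2 * lam ^ 2)) = Real.exp (-(1 / (2 * lam ^ 2)) * t ^ 2) := by
  congr 1; ring

theorem tendsto_weighted_quotient {a lam M : ℝ} (hlam : 0 < lam) {w : ℝ → ℝ}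
    (hw : ∀ t, |w t| ≤ M * (1 + |t|)) :
    Filter.Tendsto (fun s => coordDensity a lam s * (2 * s) * w s ^ 2 / (s ^ 2 - (a + 1) * lam ^ 2))
      (Filter.cocompact ℝ) (nhds 0) := by
  have hb : 0 < 1 / (2 * lam ^ 2) := by positivity
  have h1 := (tendsto_rpow_abs_mul_exp_neg_mul_sq_cocompact hb (a + 3)).const_mul (8 * M ^ 2)
  rw [mul_zero] at h1
  refine squeeze_zero_norm' ?_ h1
  filter_upwards [(tendsto_norm_cocompact_atTop (E := ℝ)).eventually_ge_atTop
    (1 + |(a + 1) * lam ^ 2|)] with s hs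
  rw [Real.norm_eq_abs] at hs
  set K := (a + 1) * lam ^ 2
  have hs1 : 1 ≤ |s| := by linarith [abs_nonneg K]
  have hφ : 1 ≤ |s ^ 2 - K| := by
    have : |s| ≤ |s| ^ 2 := by nlinarith
    have h2 := le_abs_self (s ^ 2 - K)
    have h3 := le_abs_self K
    rw [sq_abs] at this
    linarith
  have hw2 : w s ^ 2 ≤ 4 * M ^ 2 * |s| ^ 2 := by
    have h2 : |w s| ≤ M * (2 * |s|) := by
      have hM : 0 ≤ M := by
        have := (abs_nonneg _).trans (hw 0)
        simpa using this
      exact (hw s).trans (mul_le_mul_of_nonneg_left (by linarith) hM)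
    calc w s ^ 2 = |w s| ^ 2 := (sq_abs _).symm
      _ ≤ (M * (2 * |s|)) ^ 2 := by gcongr
      _ = _ := by ring
  have hd : |coordDensity a lam s| ≤ |s| ^ a * Real.exp (-(1 / (2 * lam ^ 2)) * s ^ 2) := by
    rw [coordDensity, abs_mul, Real.abs_exp, exp_gauss_eq]
    gcongr
    exact Real.abs_rpow_le_abs_rpow s a
  rw [norm_div, Real.norm_eq_abs, Real.norm_eq_abs, abs_mul, abs_mul, abs_mul, abs_two,
    abs_of_nonneg (sq_nonneg (w s))]
  have hs0 : 0 < |s| := by linarith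
  calc _ ≤ |coordDensity a lam s| * (2 * |s|) * w s ^ 2 := div_le_self (by positivity) hφ
    _ ≤ |s| ^ a * Real.exp (-(1 / (2 * lam ^ 2)) * s ^ 2) * (2 * |s|) * (4 * M ^ 2 * |s| ^ 2) := by
        gcongr
    _ = _ := by
        rw [Real.rpow_add hs0, show (3 : ℝ) = ((3 : ℕ) : ℝ) by norm_num, Real.rpow_natCast]
        ring

/-- The one-dimensional factor of the Weyl chamber. -/
noncomputable def coordSet (a : ℝ) : Set ℝ := if 0 < a then Set.Ioi 0 else Set.univ

theorem measurableSet_coordSet (a : ℝ) : MeasurableSet (coordSet a) := by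
  unfold coordSet; split_ifs
  · exact measurableSet_Ioi
  · exact MeasurableSet.univ

theorem pos_or_eq_zero_of_mem_coordSet {a t : ℝ} (ha : 0 ≤ a) (ht : t ∈ coordSet a) :
    0 < t ∨ a = 0 := by
  unfold coordSet at ht
  split_ifs at ht with h
  · exact Or.inl ht
  · exact Or.inr (le_antisymm (not_lt.mp h) ha)

theorem measurable_coordDensity (a lam : ℝ) : Measurable (coordDensity a lam) := by
  unfold coordDensity; fun_prop

theorem integrableOn_coordDensity {a lam : ℝ} (ha : 0 ≤ a) (hlam : 0 < lam) :
    IntegrableOn (coordDensity a lam) (coordSet a) := by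
  have hb : 0 < 1 / (2 * lam ^ 2) := by positivity
  have e : coordDensity a lam = fun t => t ^ a * Real.exp (-(1 / (2 * lam ^ 2)) * t ^ 2) := by
    funext t; rw [coordDensity, exp_gauss_eq]
  rw [e, coordSet]
  split_ifs with h
  · exact integrableOn_rpow_mul_exp_neg_mul_sq hb (by linarith)
  · exact (integrable_rpow_mul_exp_neg_mul_sq hb (by linarith)).integrableOn

theorem integrableOn_coordDensity_mul_sq {a lam : ℝ} (ha : 0 ≤ a) (hlam : 0 < lam) :
    IntegrableOn (fun t => coordDensity a lam t * t ^ 2) (coordSet a) := by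
  have hb : 0 < 1 / (2 * lam ^ 2) := by positivity
  rcases ha.eq_or_lt with rfl | h
  · have := integrable_rpow_mul_exp_neg_mul_sq hb (s := 2) (by norm_num)
    refine (this.congr (Filter.Eventually.of_forall fun t => ?_)).integrableOn
    simp only [coordDensity, exp_gauss_eq, Real.rpow_zero, one_mul, Real.rpow_two]
    exact mul_comm _ _
  · have := integrableOn_rpow_mul_exp_neg_mul_sq hb (s := a + 2) (by linarith)
    rw [coordSet, if_pos h]
    refine this.congr_fun (fun t ht => ?_) measurableSet_Ioi
    simp only [coordDensity, exp_gauss_eq]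
    rw [Real.rpow_add ht, Real.rpow_two]
    ring

theorem integrableOn_coordDensity_mul {a lam M : ℝ} (ha : 0 ≤ a) (hlam : 0 < lam) {g : ℝ → ℝ}
    (hg : Measurable g) (hM : ∀ t, |g t| ≤ M * (1 + t ^ 2)) :
    IntegrableOn (fun t => coordDensity a lam t * g t) (coordSet a) := by
  have h := ((integrableOn_coordDensity ha hlam).add
    (integrableOn_coordDensity_mul_sq ha hlam)).const_mul M
  refine Integrable.mono' h ((measurable_coordDensity a lam).mul hg).aestronglyMeasurable ?_
  refine (ae_restrict_iff' (measurableSet_coordSet a)).mpr (Filter.Eventually.of_forall fun t ht => ?_)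
  have h0 := coordDensity_nonneg (lam := lam) (pos_or_eq_zero_of_mem_coordSet ha ht)
  rw [norm_mul, Real.norm_eq_abs, Real.norm_eq_abs, abs_of_nonneg h0]
  refine (mul_le_mul_of_nonneg_left (hM t) h0).trans (le_of_eq ?_)
  simp only [Pi.add_apply]
  ring

/-- The ground-state inequality associated with the Laguerre polynomial `t² - (a + 1) lam²`. -/
theorem groundState_nonneg {a lam M : ℝ} (ha : 0 ≤ a) (hlam : 0 < lam) {w w' : ℝ → ℝ}
    (hw : ∀ t, HasDerivAt w (w' t) t) (hw' : Continuous w') (hM : ∀ t, |w t| ≤ M * (1 + |t|))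
    (hM' : ∀ t, |w' t| ≤ M) (hz : ∀ t ∈ coordSet a, t ^ 2 = (a + 1) * lam ^ 2 → w t = 0) :
    0 ≤ ∫ t in coordSet a, coordDensity a lam t * (w' t ^ 2 - 2 / lam ^ 2 * w t ^ 2) := by
  have hwc : Continuous w := continuous_iff_continuousAt.mpr fun t => (hw t).continuousAt
  set ψ : ℝ → ℝ := fun s =>
    coordDensity a lam s * (2 * s) * w s ^ 2 / (s ^ 2 - (a + 1) * lam ^ 2) with hψ
  set G : ℝ → ℝ := fun t => coordDensity a lam t * (w' t ^ 2 - 2 / lam ^ 2 * w t ^ 2) with hG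
  have hlim := tendsto_weighted_quotient (a := a) hlam hM
  have hGi : IntegrableOn G (coordSet a) := by
    refine integrableOn_coordDensity_mul (M := M ^ 2 + 2 / lam ^ 2 * (2 * M ^ 2)) ha hlam
      (by fun_prop) fun t => ?_
    have h1 : w' t ^ 2 ≤ M ^ 2 := sq_le_sq' (by linarith [neg_abs_le (w' t), hM' t])
      ((le_abs_self _).trans (hM' t))
    have h2 : w t ^ 2 ≤ 2 * M ^ 2 * (1 + t ^ 2) := by
      have : w t ^ 2 ≤ (M * (1 + |t|)) ^ 2 := by
        rw [← sq_abs]; gcongr; exact hM t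
      have h3 : (1 + |t|) ^ 2 ≤ 2 * (1 + t ^ 2) := by
        nlinarith [sq_nonneg (1 - |t|), sq_abs t]
      nlinarith [mul_le_mul_of_nonneg_left h3 (sq_nonneg M)]
    have h4 : 0 ≤ 2 / lam ^ 2 := by positivity
    have h5 := mul_le_mul_of_nonneg_left h2 h4
    have h6 := mul_nonneg h4 (sq_nonneg (w t))
    rw [abs_le]
    constructor <;> nlinarith [sq_nonneg (w' t), mul_nonneg (sq_nonneg M) (sq_nonneg t)]
  have hder : ∀ t ∈ coordSet a, ∃ d, HasDerivAt ψ d t ∧ d ≤ G t := by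
    intro t ht
    have ht' := pos_or_eq_zero_of_mem_coordSet ha ht
    obtain ⟨ρ', h1, h2⟩ := hasDerivAt_coordDensity (lam := lam) ht'
    exact hasDerivAt_weighted_quotient ha hlam h1 (hw t) (coordDensity_nonneg ht') h2 (hz t ht)
  have step : ∀ p q : ℝ, p ≤ q → Set.Ioo p q ⊆ coordSet a → ContinuousOn ψ (Set.Icc p q) →
      IntegrableOn G (Set.Icc p q) → ψ q - ψ p ≤ ∫ t in p..q, G t := by
    intro p q hpq hsub hc hi
    choose! d hd hd' using hder
    exact intervalIntegral.sub_le_integral_of_hasDeriv_right_of_le hpq hc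
      (fun t ht => (hd t (hsub ht)).hasDerivWithinAt) hi fun t ht => hd' t (hsub ht)
  rcases ha.eq_or_lt with rfl | h
  · have hS : coordSet 0 = Set.univ := by simp [coordSet]
    rw [hS] at hder hGi ⊢
    rw [setIntegral_univ]
    rw [integrableOn_univ] at hGi
    have hc : Continuous ψ := continuous_iff_continuousAt.mpr fun t => by
      obtain ⟨d, hd, -⟩ := hder t trivial
      exact hd.continuousAt
    have l1 := (intervalIntegral_tendsto_integral hGi Filter.tendsto_neg_atTop_atBot
      Filter.tendsto_id)
    have l2 := (hlim.mono_left atTop_le_cocompact).sub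
      ((hlim.mono_left atBot_le_cocompact).comp Filter.tendsto_neg_atTop_atBot)
    rw [sub_zero] at l2
    refine le_of_tendsto_of_tendsto l2 l1 ?_
    filter_upwards [Filter.eventually_ge_atTop 0] with R hR
    exact step (-R) R (by linarith) (by simp [hS]) hc.continuousOn hGi.integrableOn
  · have hS : coordSet a = Set.Ioi 0 := by simp [coordSet, h]
    rw [hS] at hder hGi ⊢
    have hψ0 : ψ 0 = 0 := by simp [hψ]
    have hc : ContinuousOn ψ (Set.Ici 0) := by
      intro t ht
      rcases (Set.mem_Ici.mp ht).eq_or_lt with rfl | ht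
      · have h1 : ContinuousAt (coordDensity a lam) 0 := by
          unfold coordDensity
          exact (Real.continuousAt_rpow_const _ _ (Or.inr ha)).mul (by fun_prop)
        refine ContinuousAt.continuousWithinAt (ContinuousAt.div ((h1.mul (by fun_prop)).mul
          (hwc.continuousAt.pow 2)) (by fun_prop) ?_)
        have : 0 < (a + 1) * lam ^ 2 := by positivity
        simpa using ⟨by linarith, hlam.ne'⟩
      · obtain ⟨d, hd, -⟩ := hder t ht
        exact hd.continuousAt.continuousWithinAt
    have l1 := intervalIntegral_tendsto_integral_Ioi 0 hGi Filter.tendsto_id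
    refine le_of_tendsto_of_tendsto (hlim.mono_left atTop_le_cocompact) l1 ?_
    filter_upwards [Filter.eventually_ge_atTop 0] with R hR
    have := step 0 R hR (by rw [hS]; exact fun t ht => ht.1) (hc.mono fun t ht => ht.1)
      (by
        rw [integrableOn_Icc_iff_integrableOn_Ioc]
        exact hGi.mono_set fun t ht => ht.1)
    rwa [hψ0, sub_zero] at this

/-- The mass of the one-dimensional factor of the weight. -/
noncomputable def coordMass (a lam : ℝ) : ℝ := ∫ t in coordSet a, coordDensity a lam t

/-- The unnormalized one-dimensional factor of the monomial Gaussian measure. -/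
noncomputable def coordMeasure (a lam : ℝ) : Measure ℝ :=
  (volume.restrict (coordSet a)).withDensity fun t => ENNReal.ofReal (coordDensity a lam t)

/-- The one-dimensional factor of the monomial Gaussian probability measure. -/
noncomputable def coordGauss (a lam : ℝ) : Measure ℝ :=
  (coordMeasure a lam Set.univ)⁻¹ • coordMeasure a lam

theorem ae_coordDensity_nonneg {a lam : ℝ} (ha : 0 ≤ a) :
    0 ≤ᵐ[volume.restrict (coordSet a)] coordDensity a lam :=
  (ae_restrict_iff' (measurableSet_coordSet a)).mpr (Filter.Eventually.of_forall fun _ ht =>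
    coordDensity_nonneg (pos_or_eq_zero_of_mem_coordSet ha ht))

theorem coordMeasure_univ {a lam : ℝ} (ha : 0 ≤ a) (hlam : 0 < lam) :
    coordMeasure a lam Set.univ = ENNReal.ofReal (coordMass a lam) := by
  rw [coordMeasure, withDensity_apply _ MeasurableSet.univ, Measure.restrict_univ, coordMass,
    ofReal_integral_eq_lintegral_ofReal (integrableOn_coordDensity ha hlam)
      (ae_coordDensity_nonneg ha)]

theorem coordMass_pos {a lam : ℝ} (ha : 0 ≤ a) (hlam : 0 < lam) : 0 < coordMass a lam := by
  rw [coordMass, setIntegral_pos_iff_support_of_nonneg_ae (ae_coordDensity_nonneg ha)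
    (integrableOn_coordDensity ha hlam)]
  have h : Set.Ioi (0 : ℝ) ⊆ Function.support (coordDensity a lam) ∩ coordSet a := by
    intro t ht
    refine ⟨?_, ?_⟩
    · have := Real.rpow_pos_of_pos ht a
      exact (mul_pos this (Real.exp_pos _)).ne'
    · unfold coordSet; split_ifs
      · exact ht
      · trivial
  refine lt_of_lt_of_le ?_ (measure_mono h)
  simp

theorem isProbabilityMeasure_coordGauss {a lam : ℝ} (ha : 0 ≤ a) (hlam : 0 < lam) :
    IsProbabilityMeasure (coordGauss a lam) := by
  constructor
  rw [coordGauss, Measure.smul_apply, smul_eq_mul, coordMeasure_univ ha hlam]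
  exact ENNReal.inv_mul_cancel (by simpa using coordMass_pos ha hlam) ENNReal.ofReal_ne_top

theorem integral_coordGauss {a lam : ℝ} (ha : 0 ≤ a) (hlam : 0 < lam) (g : ℝ → ℝ) :
    ∫ t, g t ∂(coordGauss a lam) =
      (coordMass a lam)⁻¹ * ∫ t in coordSet a, coordDensity a lam t * g t := by
  rw [coordGauss, integral_smul_measure, coordMeasure_univ ha hlam, ENNReal.toReal_inv,
    ENNReal.toReal_ofReal (coordMass_pos ha hlam).le, smul_eq_mul, coordMeasure,
    integral_withDensity_eq_integral_toReal_smul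
      ((measurable_coordDensity a lam).ennreal_ofReal)
      (Filter.Eventually.of_forall fun _ => ENNReal.ofReal_lt_top)]
  congr 1
  refine setIntegral_congr_fun (measurableSet_coordSet a) fun t ht => ?_
  simp only [smul_eq_mul]
  rw [ENNReal.toReal_ofReal (coordDensity_nonneg (pos_or_eq_zero_of_mem_coordSet ha ht))]

theorem coordGauss_zero {lam : ℝ} (hlam : 0 < lam) :
    coordGauss 0 lam = ProbabilityTheory.gaussianReal 0 (Real.toNNReal (lam ^ 2)) := by
  have hv : Real.toNNReal (lam ^ 2) ≠ 0 := by simpa using hlam.ne'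
  set v := Real.toNNReal (lam ^ 2) with hvd
  have hvc : (v : ℝ) = lam ^ 2 := Real.coe_toNNReal _ (sq_nonneg _)
  have hp := isProbabilityMeasure_coordGauss le_rfl hlam
  set k : ℝ := √(2 * π * v) with hk
  have hk0 : 0 < k := by rw [hk, hvc]; positivity
  have h1 : coordMeasure 0 lam = ENNReal.ofReal k • ProbabilityTheory.gaussianReal 0 v := by
    rw [ProbabilityTheory.gaussianReal_of_var_ne_zero _ hv, ← withDensity_smul _ (by fun_prop),
      coordMeasure, coordSet, if_neg (lt_irrefl _), Measure.restrict_univ]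
    congr 1
    funext t
    simp only [Pi.smul_apply, smul_eq_mul, ProbabilityTheory.gaussianPDF,
      ProbabilityTheory.gaussianPDFReal]
    rw [← ENNReal.ofReal_mul hk0.le, ← hk, ← mul_assoc, mul_inv_cancel₀ hk0.ne', coordDensity, hvc]
    simp
  rw [coordGauss, h1, Measure.smul_apply, measure_univ, smul_smul, smul_eq_mul, mul_one,
    ENNReal.inv_mul_cancel (by simpa using hk0) ENNReal.ofReal_ne_top, one_smul]

/-- The Hermite mode `t / lam` in the unweighted directions, and zero in the weighted ones. -/
noncomputable def coordMode (a lam t : ℝ) : ℝ := if 0 < a then 0 else t / lam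

theorem integral_id_coordGauss {lam : ℝ} (hlam : 0 < lam) : ∫ t, t ∂(coordGauss 0 lam) = 0 := by
  rw [coordGauss_zero hlam, ProbabilityTheory.integral_id_gaussianReal]

theorem memLp_id_coordGauss {lam : ℝ} (hlam : 0 < lam) :
    MemLp (fun t : ℝ => t) 2 (coordGauss 0 lam) := by
  rw [coordGauss_zero hlam]
  exact ProbabilityTheory.memLp_id_gaussianReal' 2 (by simp)

theorem integral_sq_coordGauss {lam : ℝ} (hlam : 0 < lam) :
    ∫ t, t ^ 2 ∂(coordGauss 0 lam) = lam ^ 2 := by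
  have h := ProbabilityTheory.variance_fun_id_gaussianReal (μ := 0) (v := Real.toNNReal (lam ^ 2))
  rw [← coordGauss_zero hlam, ProbabilityTheory.variance_eq_integral (by fun_prop),
    integral_id_coordGauss hlam, Real.coe_toNNReal _ (sq_nonneg _)] at h
  simpa using h

theorem isMode_coordMode {a lam : ℝ} (ha : 0 ≤ a) (hlam : 0 < lam) :
    IsMode (coordMode a lam) (coordGauss a lam) := by
  rcases ha.eq_or_lt with rfl | h
  · have e : coordMode 0 lam = fun t => t / lam := by funext t; simp [coordMode]
    rw [e]
    refine ⟨by fun_prop, ?_, ?_, Or.inl ?_⟩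
    · simpa [div_eq_inv_mul] using (memLp_id_coordGauss hlam).const_mul lam⁻¹
    · rw [integral_div, integral_id_coordGauss hlam, zero_div]
    · simp only [div_pow]
      rw [integral_div, integral_sq_coordGauss hlam, div_self (by positivity)]
  · have e : coordMode a lam = fun _ => 0 := by funext t; simp [coordMode, h]
    rw [e]
    exact isMode_zero _

theorem integral_deriv_coordGauss {lam C : ℝ} (hlam : 0 < lam) {f f' : ℝ → ℝ}
    (hf : ∀ t, HasDerivAt f (f' t) t) (hf' : Continuous f') (hC : ∀ t, |f t| ≤ C)
    (hC' : ∀ t, |f' t| ≤ C) :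
    lam ^ 2 * ∫ t, f' t ∂(coordGauss 0 lam) = ∫ t, t * f t ∂(coordGauss 0 lam) := by
  have hfc : Continuous f := continuous_iff_continuousAt.mpr fun t => (hf t).continuousAt
  have hC0 : 0 ≤ C := (abs_nonneg _).trans (hC 0)
  have hS : coordSet 0 = Set.univ := by simp [coordSet]
  have hbd : ∀ t : ℝ, |t| ≤ 1 + t ^ 2 := fun t => by nlinarith [sq_abs t, sq_nonneg (|t| - 1), abs_nonneg t]
  have i1 := integrableOn_coordDensity_mul (M := C) le_rfl hlam hf'.measurable fun t =>
    (hC' t).trans (by nlinarith [sq_nonneg t])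
  have i2 := integrableOn_coordDensity_mul (M := C) le_rfl hlam
    (g := fun t => t * f t) (measurable_id.mul hfc.measurable) fun t => by
      rw [abs_mul, mul_comm C]
      exact mul_le_mul (hbd t) (hC t) (abs_nonneg _) (by positivity)
  have i3 := integrableOn_coordDensity_mul (M := C) le_rfl hlam hfc.measurable fun t =>
    (hC t).trans (by nlinarith [sq_nonneg t])
  rw [hS, integrableOn_univ] at i1 i2 i3
  have hd : ∀ t, HasDerivAt (fun t => coordDensity 0 lam t * f t)
      (coordDensity 0 lam t * f' t - (lam ^ 2)⁻¹ * (coordDensity 0 lam t * (t * f t))) t := by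
    intro t
    have h1 : HasDerivAt (fun s : ℝ => Real.exp (-s ^ 2 / (2 * lam ^ 2)))
        (Real.exp (-t ^ 2 / (2 * lam ^ 2)) * (-(2 * t) / (2 * lam ^ 2))) t := by
      have h2 : HasDerivAt (fun s : ℝ => s ^ 2) (2 * t) t := by simpa using hasDerivAt_pow 2 t
      exact (h2.neg.div_const _).exp
    have e0 : coordDensity 0 lam = fun s => Real.exp (-s ^ 2 / (2 * lam ^ 2)) := by
      funext s; simp [coordDensity]
    rw [e0]
    refine (h1.mul (hf t)).congr_deriv ?_
    have e1 : -(2 * t) / (2 * lam ^ 2) = -((lam ^ 2)⁻¹ * t) := by field_simp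
    beta_reduce
    rw [e1]
    ring
  have h := integral_eq_zero_of_hasDerivAt_of_integrable hd (i1.sub (i2.const_mul _)) i3
  rw [integral_sub i1 (i2.const_mul _), integral_const_mul] at h
  rw [integral_coordGauss le_rfl hlam, integral_coordGauss le_rfl hlam, hS, setIntegral_univ,
    setIntegral_univ, sub_eq_zero.mp h]
  field_simp

theorem coordGauss_poincare_affine {a lam M : ℝ} (ha : 0 ≤ a) (hlam : 0 < lam) {w w' : ℝ → ℝ}
    (hw : ∀ t, HasDerivAt w (w' t) t) (hw' : Continuous w') (hM : ∀ t, |w t| ≤ M * (1 + |t|))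
    (hM' : ∀ t, |w' t| ≤ M) (hz : ∀ t ∈ coordSet a, t ^ 2 = (a + 1) * lam ^ 2 → w t = 0) :
    0 ≤ ∫ t, (w' t ^ 2 - 2 / lam ^ 2 * w t ^ 2) ∂(coordGauss a lam) := by
  rw [integral_coordGauss ha hlam]
  exact mul_nonneg (inv_nonneg.mpr (coordMass_pos ha hlam).le)
    (groundState_nonneg ha hlam hw hw' hM hM' hz)

theorem coordGauss_poincare_of_pos {a lam C : ℝ} (ha : 0 < a) (hlam : 0 < lam) {f f' : ℝ → ℝ}
    (hf : ∀ t, HasDerivAt f (f' t) t) (hf' : Continuous f') (hC : ∀ t, |f t| ≤ C)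
    (hC' : ∀ t, |f' t| ≤ C) :
    2 * (∫ t, f t ^ 2 ∂(coordGauss a lam) - (∫ t, f t ∂(coordGauss a lam)) ^ 2) ≤
      lam ^ 2 * ∫ t, f' t ^ 2 ∂(coordGauss a lam) := by
  have := isProbabilityMeasure_coordGauss ha.le hlam
  have hfc : Continuous f := continuous_iff_continuousAt.mpr fun t => (hf t).continuousAt
  have hC0 : 0 ≤ C := (abs_nonneg _).trans (hC 0)
  have sqb : ∀ {x : ℝ}, |x| ≤ C → |x ^ 2| ≤ C ^ 2 := fun {x} hx => by
    rw [abs_pow]; gcongr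
  set c := f (√(a + 1) * lam)
  have h := coordGauss_poincare_affine (M := 2 * C) (w := fun t => f t - c) ha.le hlam
    (fun t => (hf t).sub_const c) hf'
    (fun t => by
      have h1 := abs_sub (f t) c
      have h2 := hC (√(a + 1) * lam)
      nlinarith [hC t, mul_nonneg hC0 (abs_nonneg t)])
    (fun t => (hC' t).trans (by linarith))
    (fun t ht htz => by
      have ht0 : 0 < t := by simpa [coordSet, ha] using ht
      have : t = √(a + 1) * lam := by
        rw [← Real.sqrt_sq ht0.le, htz, Real.sqrt_mul (by linarith), Real.sqrt_sq hlam.le]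
      rw [this, sub_self])
  have i1 : Integrable (fun t => f' t ^ 2) (coordGauss a lam) :=
    integrable_of_bounded (hf'.pow 2).measurable fun t => sqb (hC' t)
  have i2 : Integrable (fun t => f t ^ 2) (coordGauss a lam) :=
    integrable_of_bounded (hfc.pow 2).measurable fun t => sqb (hC t)
  have i3 : Integrable f (coordGauss a lam) := integrable_of_bounded hfc.measurable hC
  have e : ∀ t, f' t ^ 2 - 2 / lam ^ 2 * (f t - c) ^ 2 =
      f' t ^ 2 - 2 / lam ^ 2 * (f t ^ 2 - 2 * c * f t + c ^ 2) := fun t => by ring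
  simp only [e] at h
  have i4 := i3.const_mul (2 * c)
  have i5 := integrable_const (μ := coordGauss a lam) (c ^ 2)
  rw [integral_sub i1 (by fun_prop), integral_const_mul, integral_add (by fun_prop) i5,
    integral_sub i2 i4, integral_const_mul] at h
  simp only [integral_const, probReal_univ, one_smul] at h
  have h2 := mul_nonneg (sq_nonneg lam) h
  have e2 : ∀ P Q : ℝ, lam ^ 2 * (P - 2 / lam ^ 2 * Q) = lam ^ 2 * P - 2 * Q := fun P Q => by
    field_simp
  rw [e2] at h2
  nlinarith [sq_nonneg (c - ∫ t, f t ∂(coordGauss a lam))]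

theorem coordGauss_poincare_zero {lam C : ℝ} (hlam : 0 < lam) {f f' : ℝ → ℝ}
    (hf : ∀ t, HasDerivAt f (f' t) t) (hf' : Continuous f') (hC : ∀ t, |f t| ≤ C)
    (hC' : ∀ t, |f' t| ≤ C) :
    2 * (∫ t, f t ^ 2 ∂(coordGauss 0 lam) - (∫ t, f t ∂(coordGauss 0 lam)) ^ 2) -
      (∫ t, t / lam * f t ∂(coordGauss 0 lam)) ^ 2 ≤
      lam ^ 2 * ∫ t, f' t ^ 2 ∂(coordGauss 0 lam) := by
  have := isProbabilityMeasure_coordGauss le_rfl hlam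
  have hfc : Continuous f := continuous_iff_continuousAt.mpr fun t => (hf t).continuousAt
  have hC0 : 0 ≤ C := (abs_nonneg _).trans (hC 0)
  have sqb : ∀ {x : ℝ}, |x| ≤ C → |x ^ 2| ≤ C ^ 2 := fun {x} hx => by
    rw [abs_pow]; gcongr
  set A := (f lam + f (-lam)) / 2 with hA
  set B := (f lam - f (-lam)) / (2 * lam) with hB
  have hBl : B * lam = (f lam - f (-lam)) / 2 := by rw [hB]; field_simp
  have h := coordGauss_poincare_affine (M := C + |A| + |B|) (w := fun t => f t - (A + B * t))
    (w' := fun t => f' t - B) le_rfl hlam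
    (fun t => (hf t).sub (by simpa using ((hasDerivAt_id t).const_mul B).const_add A))
    (hf'.sub continuous_const)
    (fun t => by
      have h1 := abs_sub (f t) (A + B * t)
      have h2 := abs_add_le A (B * t)
      rw [abs_mul] at h2
      nlinarith [hC t, mul_nonneg hC0 (abs_nonneg t), abs_nonneg A, abs_nonneg B,
        mul_nonneg (abs_nonneg A) (abs_nonneg t)])
    (fun t => (abs_sub _ _).trans (by linarith [hC' t, abs_nonneg A]))
    (fun t _ htz => by
      rw [zero_add, one_mul] at htz
      rcases sq_eq_sq_iff_eq_or_eq_neg.mp htz with rfl | rfl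
      · rw [hBl, hA]; ring
      · rw [mul_neg, hBl, hA]; ring)
  have hq := integral_deriv_coordGauss hlam hf hf' hC hC'
  have i1 : Integrable (fun t => f' t ^ 2) (coordGauss 0 lam) :=
    integrable_of_bounded (hf'.pow 2).measurable fun t => sqb (hC' t)
  have i2 : Integrable (fun t => f t ^ 2) (coordGauss 0 lam) :=
    integrable_of_bounded (hfc.pow 2).measurable fun t => sqb (hC t)
  have i3 : Integrable f (coordGauss 0 lam) := integrable_of_bounded hfc.measurable hC
  have i4 : Integrable f' (coordGauss 0 lam) := integrable_of_bounded hf'.measurable hC'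
  have i5 : Integrable (fun t : ℝ => t) (coordGauss 0 lam) :=
    (memLp_id_coordGauss hlam).integrable (by norm_num)
  have i6 : Integrable (fun t : ℝ => t ^ 2) (coordGauss 0 lam) :=
    (memLp_id_coordGauss hlam).integrable_sq
  have i7 : Integrable (fun t : ℝ => t * f t) (coordGauss 0 lam) :=
    (memLp_id_coordGauss hlam).integrable_mul (memLp_two_of_bounded hfc.measurable hC)
  have e : ∀ t, (f' t - B) ^ 2 - 2 / lam ^ 2 * (f t - (A + B * t)) ^ 2 =
      f' t ^ 2 + ((-(2 * B)) * f' t + (B ^ 2 + ((-(2 / lam ^ 2)) * f t ^ 2 +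
      ((2 / lam ^ 2 * (2 * A)) * f t + ((2 / lam ^ 2 * (2 * B)) * (t * f t) +
      (-(2 / lam ^ 2 * A ^ 2) + (-(2 / lam ^ 2 * (2 * A * B)) * t +
      (-(2 / lam ^ 2 * B ^ 2)) * t ^ 2))))))) := fun t => by ring
  simp only [e] at h
  have j4 := i4.const_mul (-(2 * B))
  have j2 := i2.const_mul (-(2 / lam ^ 2))
  have j3 := i3.const_mul (2 / lam ^ 2 * (2 * A))
  have j7 := i7.const_mul (2 / lam ^ 2 * (2 * B))
  have j5 := i5.const_mul (-(2 / lam ^ 2 * (2 * A * B)))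
  have j6 := i6.const_mul (-(2 / lam ^ 2 * B ^ 2))
  have k1 := integrable_const (μ := coordGauss 0 lam) (-(2 / lam ^ 2 * A ^ 2))
  have k2 := integrable_const (μ := coordGauss 0 lam) (B ^ 2)
  rw [integral_add i1 (by fun_prop), integral_add j4 (by fun_prop), integral_add k2 (by fun_prop),
    integral_add j2 (by fun_prop), integral_add j3 (by fun_prop), integral_add j7 (by fun_prop),
    integral_add k1 (by fun_prop), integral_add j5 j6,
    integral_const_mul (-(2 / lam ^ 2 * (2 * A * B))) fun t => t] at h
  simp only [integral_const_mul, integral_const, probReal_univ, one_smul,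
    integral_id_coordGauss hlam, integral_sq_coordGauss hlam, ← hq] at h
  have e3 : ∀ t, t / lam * f t = lam⁻¹ * (t * f t) := fun t => by ring
  simp only [e3]
  rw [integral_const_mul, ← hq]
  generalize ∫ t, f' t ^ 2 ∂(coordGauss 0 lam) = P at *
  generalize ∫ t, f t ^ 2 ∂(coordGauss 0 lam) = Q at *
  generalize ∫ t, f' t ∂(coordGauss 0 lam) = q at *
  generalize ∫ t, f t ∂(coordGauss 0 lam) = m at *
  have h2 := mul_nonneg (sq_nonneg lam) h
  have h3 : 0 ≤ lam ^ 2 * P - 2 * Q + 2 * B * q * lam ^ 2 - B ^ 2 * lam ^ 2 + 4 * A * m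
      - 2 * A ^ 2 := by
    refine h2.trans (le_of_eq ?_)
    field_simp
    ring
  have h4 : lam⁻¹ * (lam ^ 2 * q) = lam * q := by
    rw [sq, mul_assoc, inv_mul_cancel_left₀ hlam.ne']
  rw [h4, mul_pow]
  nlinarith [sq_nonneg (A - m), mul_nonneg (sq_nonneg lam) (sq_nonneg (B - q))]

theorem coordGauss_poincare {a lam C : ℝ} (ha : 0 ≤ a) (hlam : 0 < lam) {f f' : ℝ → ℝ}
    (hf : ∀ t, HasDerivAt f (f' t) t) (hf' : Continuous f') (hC : ∀ t, |f t| ≤ C)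
    (hC' : ∀ t, |f' t| ≤ C) :
    2 * (∫ t, f t ^ 2 ∂(coordGauss a lam) - (∫ t, f t ∂(coordGauss a lam)) ^ 2) -
      (∫ t, coordMode a lam t * f t ∂(coordGauss a lam)) ^ 2 ≤
      lam ^ 2 * ∫ t, f' t ^ 2 ∂(coordGauss a lam) := by
  rcases ha.eq_or_lt with rfl | h
  · simpa [coordMode] using coordGauss_poincare_zero hlam hf hf' hC hC'
  · simpa [coordMode, h] using coordGauss_poincare_of_pos h hlam hf hf' hC hC'

theorem lintegral_ofReal_prod {n : ℕ} {ν : Fin n → Measure ℝ} [∀ i, SigmaFinite (ν i)]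
    {ρ : Fin n → ℝ → ℝ} (hρ : ∀ i, Integrable (ρ i) (ν i)) (h0 : ∀ i, 0 ≤ᵐ[ν i] ρ i) :
    ∫⁻ x, ENNReal.ofReal (∏ i, ρ i (x i)) ∂(Measure.pi ν) =
      ∏ i, ∫⁻ t, ENNReal.ofReal (ρ i t) ∂(ν i) := by
  have h1 : ∀ᵐ x ∂(Measure.pi ν), ∀ i, 0 ≤ ρ i (x i) :=
    ae_all_iff.mpr fun i => Measure.tendsto_eval_ae_ae.eventually (h0 i)
  rw [← ofReal_integral_eq_lintegral_ofReal (Integrable.fintype_prod hρ)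
    (h1.mono fun x hx => Finset.prod_nonneg fun i _ => hx i), integral_fintype_prod_eq_prod,
    ENNReal.ofReal_prod_of_nonneg fun i _ => integral_nonneg_of_ae (h0 i)]
  exact Finset.prod_congr rfl fun i _ => ofReal_integral_eq_lintegral_ofReal (hρ i) (h0 i)

theorem pi_withDensity_ofReal {n : ℕ} {ν : Fin n → Measure ℝ} [∀ i, SigmaFinite (ν i)]
    {ρ : Fin n → ℝ → ℝ} (hρ : ∀ i, Integrable (ρ i) (ν i)) (h0 : ∀ i, 0 ≤ᵐ[ν i] ρ i) :
    Measure.pi (fun i => (ν i).withDensity fun t => ENNReal.ofReal (ρ i t)) =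
      (Measure.pi ν).withDensity fun x => ENNReal.ofReal (∏ i, ρ i (x i)) := by
  have : ∀ i, IsFiniteMeasure ((ν i).withDensity fun t => ENNReal.ofReal (ρ i t)) :=
    fun i => isFiniteMeasure_withDensity_ofReal (hρ i).2
  refine Measure.pi_eq fun s hs => ?_
  rw [withDensity_apply _ (MeasurableSet.univ_pi hs), Measure.restrict_pi_pi,
    lintegral_ofReal_prod (fun i => (hρ i).restrict) fun i => ae_restrict_of_ae (h0 i)]
  exact Finset.prod_congr rfl fun i _ => (withDensity_apply _ (hs i)).symm

theorem measurableSet_chamber {N : ℕ} (α : Fin N → ℝ) : MeasurableSet (chamber α) := by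
  unfold chamber
  simp only [Set.ofPred_forall]
  exact MeasurableSet.iInter fun i => MeasurableSet.iInter fun _ =>
    measurableSet_lt measurable_const (by fun_prop)

theorem measurable_monWeight {N : ℕ} (α : Fin N → ℝ) : Measurable (monWeight α) := by
  unfold monWeight
  fun_prop

theorem monWeight_mul_exp {N : ℕ} (α : Fin N → ℝ) (lam : ℝ) (x : EuclideanSpace ℝ (Fin N)) :
    monWeight α x * Real.exp (-‖x‖ ^ 2 / (2 * lam ^ 2)) = ∏ i, coordDensity (α i) lam (x i) := by
  simp only [coordDensity]
  rw [Finset.prod_mul_distrib, ← Real.exp_sum, monWeight, EuclideanSpace.norm_sq_eq,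
    ← Finset.sum_neg_distrib, Finset.sum_div]
  simp only [Real.norm_eq_abs, sq_abs]

theorem preimage_toLp_chamber {N : ℕ} {α : Fin N → ℝ} :
    WithLp.toLp 2 ⁻¹' chamber α = Set.univ.pi fun i => coordSet (α i) := by
  ext x
  simp only [chamber, coordSet, Set.mem_preimage, Set.mem_ofPred_eq, Set.mem_pi, Set.mem_univ,
    true_implies]
  refine forall_congr' fun i => ?_
  split_ifs with h <;> simp [h]

theorem map_toLp_pi_coordMeasure {N : ℕ} {α : Fin N → ℝ} (hα : ∀ i, 0 ≤ α i) {lam : ℝ}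
    (hlam : 0 < lam) :
    (Measure.pi fun i => coordMeasure (α i) lam).map (MeasurableEquiv.toLp 2 (Fin N → ℝ)) =
      (volume.restrict (chamber α)).withDensity
        fun x => ENNReal.ofReal (monWeight α x * Real.exp (-‖x‖ ^ 2 / (2 * lam ^ 2))) := by
  have hmp := (PiLp.volume_preserving_toLp (Fin N)).restrict_preimage (measurableSet_chamber α)
  rw [preimage_toLp_chamber, volume_pi, Measure.restrict_pi_pi] at hmp
  have e : (Measure.pi fun i => coordMeasure (α i) lam) = _ :=
    pi_withDensity_ofReal (fun i => integrableOn_coordDensity (hα i) hlam)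
      fun i => ae_coordDensity_nonneg (lam := lam) (hα i)
  rw [e]
  have hm := measurable_monWeight α
  ext s hs
  rw [MeasurableEquiv.map_apply, withDensity_apply _ hs,
    withDensity_apply _ ((MeasurableEquiv.toLp 2 (Fin N → ℝ)).measurable hs),
    ← hmp.setLIntegral_comp_preimage hs (by fun_prop)]
  simp only [monWeight_mul_exp]
  rfl

theorem pi_coordGauss {N : ℕ} {α : Fin N → ℝ} (hα : ∀ i, 0 ≤ α i) {lam : ℝ} (hlam : 0 < lam) :
    Measure.pi (fun i => coordGauss (α i) lam) =
      (Measure.pi (fun i => coordMeasure (α i) lam) Set.univ)⁻¹ •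
        Measure.pi fun i => coordMeasure (α i) lam := by
  have := fun i => isProbabilityMeasure_coordGauss (hα i) hlam
  have : ∀ i, IsFiniteMeasure (coordMeasure (α i) lam) := fun i =>
    ⟨by rw [coordMeasure_univ (hα i) hlam]; exact ENNReal.ofReal_lt_top⟩
  refine Measure.pi_eq fun s hs => ?_
  rw [Measure.smul_apply, Measure.pi_pi, Measure.pi_univ, ENNReal.prod_inv_distrib, smul_eq_mul,
    ← Finset.prod_mul_distrib]
  · rfl
  · exact fun i _ j _ _ => Or.inr (measure_ne_top _ _)

/-- The monomial Gaussian measure is a product of one-dimensional measures. -/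
theorem monGaussScaled_eq_map {N : ℕ} {α : Fin N → ℝ} (hα : ∀ i, 0 ≤ α i) {lam : ℝ}
    (hlam : 0 < lam) :
    monGaussScaled α lam =
      (Measure.pi fun i => coordGauss (α i) lam).map (MeasurableEquiv.toLp 2 (Fin N → ℝ)) := by
  rw [pi_coordGauss hα hlam, Measure.map_smul, monGaussScaled, ← map_toLp_pi_coordMeasure hα hlam,
    MeasurableEquiv.map_apply, Set.preimage_univ]

theorem integral_monGaussScaled {N : ℕ} {α : Fin N → ℝ} (hα : ∀ i, 0 ≤ α i) {lam : ℝ}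
    (hlam : 0 < lam) (F : EuclideanSpace ℝ (Fin N) → ℝ) :
    ∫ x, F x ∂(monGaussScaled α lam) =
      ∫ x, F (WithLp.toLp 2 x) ∂(Measure.pi fun i => coordGauss (α i) lam) := by
  rw [monGaussScaled_eq_map hα hlam, integral_map_equiv]
  rfl

theorem integral_coord_monGauss_eq_zero {N : ℕ} {α : Fin N → ℝ} (hα : ∀ i, 0 ≤ α i) {i : Fin N}
    (hi : ¬ 0 < α i) : ∫ z : EuclideanSpace ℝ (Fin N), z i ∂(monGauss α) = 0 := by
  have := fun i => isProbabilityMeasure_coordGauss (hα i) one_pos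
  rw [monGauss, integral_monGaussScaled hα one_pos]
  have h := integral_comp_eval (μ := fun i => coordGauss (α i) 1) (i := i) (f := fun t : ℝ => t)
    (by fun_prop)
  simp only at h ⊢
  rw [h, le_antisymm (not_lt.mp hi) (hα i), integral_id_coordGauss one_pos]

theorem norm_gradient_sq {N : ℕ} (u : EuclideanSpace ℝ (Fin N) → ℝ)
    (x : EuclideanSpace ℝ (Fin N)) :
    ‖gradient u x‖ ^ 2 = ∑ i, fderiv ℝ u x (EuclideanSpace.single i 1) ^ 2 := by
  rw [EuclideanSpace.norm_sq_eq]
  refine Finset.sum_congr rfl fun i _ => ?_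
  rw [← inner_gradient_left, EuclideanSpace.inner_single_right]
  simp

theorem hasDerivAt_comp_update {N : ℕ} {u : EuclideanSpace ℝ (Fin N) → ℝ}
    (hu : Differentiable ℝ u) (x : Fin N → ℝ) (i : Fin N) (t : ℝ) :
    HasDerivAt (fun s => u (WithLp.toLp 2 (Function.update x i s)))
      (fderiv ℝ u (WithLp.toLp 2 (Function.update x i t)) (EuclideanSpace.single i 1)) t := by
  have h := (PiLp.hasFDerivAt_toLp 2 (Function.update x i t)).comp_hasDerivAt t
    (hasDerivAt_update x i t)
  exact ((hu _).hasFDerivAt).comp_hasDerivAt t h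

/-- The sharpened Poincaré inequality, in expanded form. -/
theorem poincare_monGaussScaled {N : ℕ} {α : Fin N → ℝ} (hα : ∀ i, 0 ≤ α i) {lam : ℝ}
    (hlam : 0 < lam) {u : EuclideanSpace ℝ (Fin N) → ℝ} (hu : ContDiff ℝ 1 u)
    (hs : HasCompactSupport u) :
    2 * (∫ x, u (WithLp.toLp 2 x) ^ 2 ∂(Measure.pi fun i => coordGauss (α i) lam) -
        (∫ x, u (WithLp.toLp 2 x) ∂(Measure.pi fun i => coordGauss (α i) lam)) ^ 2) -
        ∑ i, (∫ x, coordMode (α i) lam (x i) * u (WithLp.toLp 2 x)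
          ∂(Measure.pi fun i => coordGauss (α i) lam)) ^ 2 ≤
      lam ^ 2 * ∫ x, ‖gradient u x‖ ^ 2 ∂(monGaussScaled α lam) := by
  have := fun i => isProbabilityMeasure_coordGauss (hα i) hlam
  have hd : Continuous (fderiv ℝ u) := hu.continuous_fderiv one_ne_zero
  obtain ⟨C₁, hC₁⟩ := hs.exists_bound_of_continuous hu.continuous
  have hb : ∃ C, ∀ i x, |fderiv ℝ u x (EuclideanSpace.single i 1)| ≤ C := by
    obtain ⟨C, hC⟩ := (hs.fderiv ℝ).exists_bound_of_continuous hd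
    refine ⟨C, fun i x => ?_⟩
    refine ((fderiv ℝ u x).le_opNorm _).trans ?_
    simpa using hC x
  obtain ⟨C₂, hC₂⟩ := hb
  have hdi : ∀ i, Continuous fun x : Fin N → ℝ =>
      fderiv ℝ u (WithLp.toLp 2 x) (EuclideanSpace.single i 1) := fun i => by fun_prop
  have hsq : ∀ i x, |fderiv ℝ u x (EuclideanSpace.single i 1) ^ 2| ≤ C₂ ^ 2 := fun i x => by
    rw [abs_pow]
    gcongr
    exact hC₂ i x
  refine (tensorized_poincare (fun i => coordGauss (α i) lam)
    (fun i => isMode_coordMode (hα i) hlam) (f := fun x => u (WithLp.toLp 2 x)) (C := C₁)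
    (hu.continuous.comp (by fun_prop)).measurable (fun x => hC₁ _)
    (g := fun i x => lam ^ 2 * fderiv ℝ u (WithLp.toLp 2 x) (EuclideanSpace.single i 1) ^ 2)
    (D := lam ^ 2 * C₂ ^ 2) (fun i => (((hdi i).pow 2).const_mul _).measurable) (fun i x => ?_)
    fun i x => ?_).trans (le_of_eq ?_)
  · rw [abs_mul, abs_of_nonneg (sq_nonneg lam)]
    exact mul_le_mul_of_nonneg_left (hsq i _) (sq_nonneg lam)
  · rw [integral_const_mul]
    exact coordGauss_poincare (C := max C₁ C₂) (hα i) hlam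
      (hasDerivAt_comp_update (hu.differentiable one_ne_zero) x i)
      ((hdi i).comp (by fun_prop)) (fun t => (hC₁ _).trans (le_max_left _ _))
      fun t => (hC₂ i _).trans (le_max_right _ _)
  · simp only [integral_const_mul]
    rw [← Finset.mul_sum, integral_monGaussScaled hα hlam]
    simp only [norm_gradient_sq]
    have hi : ∀ i, Integrable (fun x : Fin N → ℝ =>
        fderiv ℝ u (WithLp.toLp 2 x) (EuclideanSpace.single i 1) ^ 2)
        (Measure.pi fun i => coordGauss (α i) lam) := fun i =>
      integrable_of_bounded ((hdi i).pow 2).measurable fun x => hsq i _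
    rw [integral_finsetSum _ fun i _ => hi i]

theorem sum_mul_coordMode {N : ℕ} {α : Fin N → ℝ} {lam : ℝ} (q x : Fin N → ℝ) :
    ∑ i, q i * coordMode (α i) lam (x i) =
      ∑ i, (if 0 < α i then 0 else q i / lam) * x i := by
  refine Finset.sum_congr rfl fun i _ => ?_
  rw [coordMode]
  split_ifs
  · simp
  · ring

/-- Improved scale-dependent Poincaré inequality with monomial Gaussian weight:
`∫|∇u|² dμ_{A,λ} ≥ (1/λ²) inf_{c,d} ∫ [ |u−c|²
  + (1/2)|u − c + d·∫x dμ_A − c|∫x dμ_A|² − d·x + c(∫x dμ_A)·x|² ] dμ_{A,λ}`. -/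
theorem improved_scale_poincare_monomial_gaussian {N : ℕ} (hN : 1 ≤ N) (α : Fin N → ℝ)
    (hα : ∀ i, 0 ≤ α i) (lam : ℝ) (hlam : 0 < lam)
    (u : EuclideanSpace ℝ (Fin N) → ℝ) (hu : NstarClass α u) :
    let w : Fin N → ℝ := fun j => ∫ z : EuclideanSpace ℝ (Fin N), z j ∂(monGauss α)
    ∫ x, ‖gradient u x‖ ^ 2 ∂(monGaussScaled α lam) ≥
      (1 / lam ^ 2) * ⨅ (c : ℝ) (d : Fin N → ℝ),
        ∫ x, ((u x - c) ^ 2 +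
          (1 / 2) * (u x - c + (∑ j, d j * w j) - c * (∑ j, (w j) ^ 2)
            - (∑ j, d j * x j) + c * ∑ j, w j * x j) ^ 2) ∂(monGaussScaled α lam) := by
  intro w
  have := fun i => isProbabilityMeasure_coordGauss (hα i) hlam
  have hu1 : ContDiff ℝ 1 u := hu.1.of_le (by exact_mod_cast le_top)
  have hP := poincare_monGaussScaled hα hlam hu1 hu.2.1
  obtain ⟨C, hC⟩ := hu.2.1.exists_bound_of_continuous hu1.continuous
  have hh := fun i => isMode_coordMode (hα i) hlam
  set f : (Fin N → ℝ) → ℝ := fun x => u (WithLp.toLp 2 x)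
  have hfm : Measurable f := (hu1.continuous.comp (by fun_prop)).measurable
  have hf2 : MemLp f 2 (Measure.pi fun i => coordGauss (α i) lam) :=
    memLp_two_of_bounded hfm fun x => hC _
  set m := ∫ x, f x ∂(Measure.pi fun i => coordGauss (α i) lam) with hm
  set q : Fin N → ℝ := fun i => ∫ x, coordMode (α i) lam (x i) * f x
    ∂(Measure.pi fun i => coordGauss (α i) lam) with hq
  have hB : ∑ i, q i ^ 2 ≤ _ := bessel_modes hh hf2
  have hR : ∫ x, (f x - m - ∑ i, q i * coordMode (α i) lam (x i)) ^ 2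
    ∂(Measure.pi fun i => coordGauss (α i) lam) = _ := integral_sub_modes_sq hh hf2
  set b : Fin N → ℝ := fun i => if 0 < α i then 0 else q i / lam with hb
  have hbw : ∑ j, b j * w j = 0 := Finset.sum_eq_zero fun j _ => by
    by_cases h : 0 < α j
    · simp [hb, h]
    · have : w j = 0 := integral_coord_monGauss_eq_zero hα h
      rw [this, mul_zero]
  have hmode : MemLp (fun x : Fin N → ℝ => ∑ i, q i * coordMode (α i) lam (x i)) 2
      (Measure.pi fun i => coordGauss (α i) lam) :=
    memLp_finsetSum _ fun i _ => (memLp_coord i (hh i).memLp).const_mul (q i)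
  have hi1 : MemLp (fun x => f x - m) 2 (Measure.pi fun i => coordGauss (α i) lam) :=
    hf2.sub (memLp_const m)
  have hi2 : MemLp (fun x => f x - m - ∑ i, q i * coordMode (α i) lam (x i)) 2
      (Measure.pi fun i => coordGauss (α i) lam) := hi1.sub hmode
  have hval : ∫ x, ((u x - m) ^ 2 + (1 / 2) * (u x - m + (∑ j, (b j + m * w j) * w j)
      - m * (∑ j, (w j) ^ 2) - (∑ j, (b j + m * w j) * x j) + m * ∑ j, w j * x j) ^ 2)
      ∂(monGaussScaled α lam) ≤ lam ^ 2 * ∫ x, ‖gradient u x‖ ^ 2 ∂(monGaussScaled α lam) := by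
    have e : ∀ x : EuclideanSpace ℝ (Fin N), u x - m + (∑ j, (b j + m * w j) * w j)
        - m * (∑ j, (w j) ^ 2) - (∑ j, (b j + m * w j) * x j) + m * ∑ j, w j * x j
        = u x - m - ∑ i, q i * coordMode (α i) lam (x i) := fun x => by
      rw [sum_mul_coordMode]
      simp only [add_mul, Finset.sum_add_distrib, hbw, mul_assoc, ← Finset.mul_sum, ← sq]
      ring
    simp only [e]
    rw [integral_monGaussScaled hα hlam]
    change ∫ x, ((f x - m) ^ 2 +
      (1 / 2) * (f x - m - ∑ i, q i * coordMode (α i) lam (x i)) ^ 2) ∂_ ≤ _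
    rw [integral_add hi1.integrable_sq (hi2.integrable_sq.const_mul _), integral_const_mul, hR]
    have h0 : ∫ x, (f x - m) ^ 2 ∂(Measure.pi fun i => coordGauss (α i) lam) =
        ∫ x, f x ^ 2 ∂(Measure.pi fun i => coordGauss (α i) lam) - m ^ 2 := by
      have e : ∀ x, (f x - m) ^ 2 = f x ^ 2 - 2 * m * f x + m ^ 2 := fun x => by ring
      have j1 := hf2.integrable_sq
      have j2 := (hf2.integrable (by norm_num)).const_mul (2 * m)
      simp only [e]
      rw [integral_add (by fun_prop) (integrable_const _), integral_sub j1 j2, integral_const_mul,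
        ← hm]
      simp only [integral_const, probReal_univ, one_smul]
      ring
    rw [h0]
    linarith
  have hnn : ∀ (c : ℝ) (d : Fin N → ℝ), 0 ≤ ∫ x : EuclideanSpace ℝ (Fin N), ((u x - c) ^ 2 +
      (1 / 2) * (u x - c + (∑ j, d j * w j) - c * (∑ j, (w j) ^ 2)
        - (∑ j, d j * x j) + c * ∑ j, w j * x j) ^ 2) ∂(monGaussScaled α lam) :=
    fun c d => integral_nonneg fun x => by positivity
  rw [ge_iff_le, one_div, inv_mul_le_iff₀ (by positivity)]
  refine (ciInf_le ⟨0, ?_⟩ m).trans ((ciInf_le ⟨0, ?_⟩ fun j => b j + m * w j).trans hval)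
  · rintro _ ⟨c, rfl⟩
    exact Real.iInf_nonneg (hnn c)
  · rintro _ ⟨d, rfl⟩
    exact hnn m d
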